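/- Fix an integer r ≥ 1 and n ≥ 2r, and let 0 < c ≤ 1. There is a constant C_r(c) > 0 depending only on r and c such that for every σ > 0, every V ≥ 0, and every θ* ∈ ℝ^n satisfying the minimum length condition with constant c, the constrained trend filtering estimator with tuning parameter V satisfies R(θ̂^{(r)}_V, θ*) ≤ (V − V^{(r)}(θ*))² + C_r(c)·(σ²(k_r(θ*)+1)/n)·log(en/(k_r(θ*)+1)). -/

import Mathlib

open MeasureTheory ProbabilityTheory
open scoped BigOperators

noncomputable section

/-- Zero-padding of a finite vector to a sequence on `ℕ`. -/
def pad {n : ℕ} (θ : Fin n → ℝ) : ℕ → ℝ := fun t => if h : t < n then θ ⟨t, h⟩ else 0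

/-- First-order forward difference of a sequence. -/
def dseq (f : ℕ → ℝ) : ℕ → ℝ := fun t => f (t + 1) - f t

/-- `DD r θ t` is the `t`-th entry (0-indexed) of the `r`-th order difference `D^{(r)} θ`
of the vector `θ ∈ ℝ^n`; only the entries `t < n - r` are meaningful. -/
def DD (r : ℕ) {n : ℕ} (θ : Fin n → ℝ) : ℕ → ℝ := dseq^[r] (pad θ)

/-- The ℓ¹ norm `‖D^{(r)} θ‖₁`. -/
def Dl1 (r : ℕ) {n : ℕ} (θ : Fin n → ℝ) : ℝ := ∑ t ∈ Finset.range (n - r), |DD r θ t|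

/-- The number of nonzero entries `‖D^{(r)} θ‖₀`. -/
def Dl0 (r : ℕ) {n : ℕ} (θ : Fin n → ℝ) : ℕ :=
  ((Finset.range (n - r)).filter fun t => DD r θ t ≠ 0).card

/-- Squared Euclidean norm. -/
def sqnorm {n : ℕ} (x : Fin n → ℝ) : ℝ := ∑ i, x i ^ 2

/-- Euclidean norm. -/
def eunorm {n : ℕ} (x : Fin n → ℝ) : ℝ := Real.sqrt (sqnorm x)

/-- `V^{(r)}(θ) = n^{r-1} ‖D^{(r)} θ‖₁`. -/
def Vr (r : ℕ) {n : ℕ} (θ : Fin n → ℝ) : ℝ := (n : ℝ) ^ ((r : ℤ) - 1) * Dl1 r θ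

/-- The constraint set `K^{(r)}(V) = {θ : ‖D^{(r)} θ‖₁ ≤ V n^{1-r}}`. -/
def Kset (r n : ℕ) (V : ℝ) : Set (Fin n → ℝ) := {θ | Dl1 r θ ≤ V * (n : ℝ) ^ (1 - (r : ℤ))}

/-- `est` is a least-squares projection onto the set `K`. -/
def IsProjOn {n : ℕ} (est : (Fin n → ℝ) → Fin n → ℝ) (K : Set (Fin n → ℝ)) : Prop :=
  ∀ y, est y ∈ K ∧ ∀ θ ∈ K, sqnorm (y - est y) ≤ sqnorm (y - θ)

/-- `est` is the penalized trend filtering estimator of order `r` with noise level `σ`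
and tuning parameter `lam`: it minimizes `½‖y - θ‖² + σ n^{r-1} lam ‖D^{(r)} θ‖₁`. -/
def IsPenEst (r : ℕ) {n : ℕ} (σ lam : ℝ) (est : (Fin n → ℝ) → Fin n → ℝ) : Prop :=
  ∀ y θ, 1 / 2 * sqnorm (y - est y) + σ * (n : ℝ) ^ ((r : ℤ) - 1) * lam * Dl1 r (est y) ≤
    1 / 2 * sqnorm (y - θ) + σ * (n : ℝ) ^ ((r : ℤ) - 1) * lam * Dl1 r θ

/-- The Gaussian measure `N_n(0, σ² I_n)` on `ℝ^n`. -/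
def gaussVec (n : ℕ) (σ : ℝ) : Measure (Fin n → ℝ) :=
  Measure.pi fun _ => gaussianReal 0 (σ ^ 2).toNNReal

/-- The risk `R(θ̂, θ*) = (1/n) E ‖θ̂(θ* + ξ) - θ*‖²` for `ξ ∼ N_n(0, σ² I_n)`. -/
def risk {n : ℕ} (σ : ℝ) (est : (Fin n → ℝ) → Fin n → ℝ) (θs : Fin n → ℝ) : ℝ :=
  1 / (n : ℝ) * ∫ ξ, sqnorm (est (θs + ξ) - θs) ∂gaussVec n σ

/-- `j` (with signs `sg`) enumerates, in increasing order and paper (1-indexed) convention,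
exactly the `r`-th order knots of `θ ∈ ℝ^n`; an index `2 ≤ m ≤ n - r + 1` is a knot when
`(D^{(r-1)}θ)_{m-1} ≠ (D^{(r-1)}θ)_m` (1-indexed entries), and its sign is `+1` when
`(D^{(r-1)}θ)_{m-1} < (D^{(r-1)}θ)_m` and `-1` otherwise. -/
def IsKnotSeq (r n : ℕ) (θ : Fin n → ℝ) (k : ℕ) (j : Fin k → ℕ) (sg : Fin k → ℝ) : Prop :=
  StrictMono j ∧ (∀ i, 2 ≤ j i ∧ j i ≤ n - r + 1) ∧
    (∀ m : ℕ, 2 ≤ m → m ≤ n - r + 1 →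
      (DD (r - 1) θ (m - 2) ≠ DD (r - 1) θ (m - 1) ↔ ∃ i, j i = m)) ∧
    ∀ i, sg i = if DD (r - 1) θ (j i - 2) < DD (r - 1) θ (j i - 1) then 1 else -1

/-- Extended knot sequence: `jext 0 = j_0 = 1`, `jext i = j_i` for `1 ≤ i ≤ k`, and
`jext (k+1) = j_{k+1} = n - r + 2`. -/
def jext (n r k : ℕ) (j : Fin k → ℕ) : ℕ → ℕ := fun i =>
  if i = 0 then 1 else if h : i - 1 < k then j ⟨i - 1, h⟩ else n - r + 2

/-- Extended sign sequence: `sgext i = 𝔯_i` for `1 ≤ i ≤ k` and `0` otherwise. -/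
def sgext (k : ℕ) (sg : Fin k → ℝ) : ℕ → ℝ := fun i =>
  if h : 0 < i ∧ i - 1 < k then sg ⟨i - 1, h.2⟩ else 0

/-- The lengths `n_0 = j_1 + r - 2`, `n_i = j_{i+1} - j_i` (`1 ≤ i ≤ k-1`),
`n_k = n - r + 2 - j_k`. -/
def nlen (n r k : ℕ) (j : Fin k → ℕ) : ℕ → ℕ := fun i =>
  if i = 0 then jext n r k j 1 + r - 2 else jext n r k j (i + 1) - jext n r k j i

/-- `n_{i*} = min(n_i, n/(k+1))`. -/
def nstar (n r k : ℕ) (j : Fin k → ℕ) (i : ℕ) : ℝ :=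
  min (nlen n r k j i : ℝ) ((n : ℝ) / ((k : ℝ) + 1))

/-- `δ_r(θ)²` defined from the knot data of `θ`. -/
def deltaSq (n r k : ℕ) (j : Fin k → ℕ) (sg : Fin k → ℝ) : ℝ :=
  nstar n r k j 0 ^ (1 - 2 * (r : ℤ)) + nstar n r k j k ^ (1 - 2 * (r : ℤ)) +
    ∑ i ∈ Finset.Ico 1 k,
      if sgext k sg i ≠ sgext k sg (i + 1) then nstar n r k j i ^ (1 - 2 * (r : ℤ)) else 0

/-- `Δ_r(θ)` defined from the knot data of `θ`. -/
def DeltaR (n r k : ℕ) (j : Fin k → ℕ) (sg : Fin k → ℝ) : ℝ :=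
  ((k : ℝ) + 1) / (n : ℝ) * Real.log (Real.exp 1 * (n : ℝ) / ((k : ℝ) + 1)) +
    deltaSq n r k j sg / (n : ℝ) * ((n : ℝ) / ((k : ℝ) + 1)) ^ (2 * (r : ℤ) - 1) *
      Real.log (Real.exp 1 * (n : ℝ) / ((k : ℝ) + 1)) +
    (Real.sqrt (deltaSq n r k j sg) / Real.sqrt (n : ℝ)) ^ ((1 : ℝ) / (r : ℝ))

/-- The minimum length condition with constant `c`: `n_i ≥ c n/(k+1)` for every `0 ≤ i ≤ k`
with `𝔯_i ≠ 𝔯_{i+1}` (where `𝔯_0 = 𝔯_{k+1} = 0`). -/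
def MinLen (n r k : ℕ) (j : Fin k → ℕ) (sg : Fin k → ℝ) (c : ℝ) : Prop :=
  ∀ i ≤ k, sgext k sg i ≠ sgext k sg (i + 1) →
    c * (n : ℝ) / ((k : ℝ) + 1) ≤ (nlen n r k j i : ℝ)

/-- The subdifferential of `g` at `θ`. -/
def subdiff {n : ℕ} (g : (Fin n → ℝ) → ℝ) (θ : Fin n → ℝ) : Set (Fin n → ℝ) :=
  {v | ∀ y, g θ + ∑ i, v i * (y i - θ i) ≤ g y}

/-- `v` is the minimum-norm element of `S`. -/
def IsMinNormIn {n : ℕ} (v : Fin n → ℝ) (S : Set (Fin n → ℝ)) : Prop :=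
  v ∈ S ∧ ∀ w ∈ S, eunorm v ≤ eunorm w

/-- `c • S`. -/
def scaleSet {n : ℕ} (c : ℝ) (S : Set (Fin n → ℝ)) : Set (Fin n → ℝ) := (c • ·) '' S

/-- The cone generated by `S`: `⋃_{c ≥ 0} c • S`. -/
def coneOf {n : ℕ} (S : Set (Fin n → ℝ)) : Set (Fin n → ℝ) := ⋃ c ∈ Set.Ici (0 : ℝ), scaleSet c S

/-- Euclidean distance from a point to a set. -/
def distSet {n : ℕ} (z : Fin n → ℝ) (S : Set (Fin n → ℝ)) : ℝ :=
  sInf ((fun v => eunorm (z - v)) '' S)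

/-- Gaussian mean squared distance `D(S) = E dist²(Z, S)`, `Z ∼ N_n(0, I_n)`. -/
def gaussMSD {n : ℕ} (S : Set (Fin n → ℝ)) : ℝ := ∫ z, distSet z S ^ 2 ∂gaussVec n 1

/-- `lam z` is, for each `z`, the minimizer over `λ ≥ 0` of `dist(z, λ S)`. -/
def IsLamFun {n : ℕ} (S : Set (Fin n → ℝ)) (lam : (Fin n → ℝ) → ℝ) : Prop :=
  ∀ z, 0 ≤ lam z ∧ ∀ μ : ℝ, 0 ≤ μ → distSet z (scaleSet (lam z) S) ≤ distSet z (scaleSet μ S)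

/-- Euclidean covering number of `K` at scale `ε`. -/
def covN {n : ℕ} (ε : ℝ) (K : Set (Fin n → ℝ)) : ℕ :=
  sInf {m : ℕ | ∃ a : Fin m → Fin n → ℝ, ∀ x ∈ K, ∃ i, eunorm (x - a i) ≤ ε}

/-- `K` `t`-shatters the (finite) index set `A`. -/
def fatShatters {n : ℕ} (K : Set (Fin n → ℝ)) (t : ℝ) (A : Finset (Fin n)) : Prop :=
  ∃ h : Fin n → ℝ, ∀ S : Finset (Fin n), S ⊆ A →
    ∃ θ ∈ K, (∀ i ∈ S, θ i ≤ h i) ∧ ∀ i ∈ A, i ∉ S → h i + t ≤ θ i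

/-- The fat shattering dimension `v(K, t)`. -/
def fatDim {n : ℕ} (K : Set (Fin n → ℝ)) (t : ℝ) : ℕ :=
  sSup {m : ℕ | ∃ A : Finset (Fin n), A.card = m ∧ fatShatters K t A}

/-- The tangent cone of `K` at `θ`. -/
def tanCone {n : ℕ} (K : Set (Fin n → ℝ)) (θ : Fin n → ℝ) : Set (Fin n → ℝ) :=
  closure {w | ∃ t : ℝ, 0 ≤ t ∧ ∃ η ∈ K, w = t • (η - θ)}

/-- `V_{a,b}(f) = Σ_{m=a+1}^{b} |f_m - f_{m-1}|` for the (paper 1-indexed) sequence whose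
`m`-th entry is `f (m-1)`. -/
def Vab (f : ℕ → ℝ) (a b : ℕ) : ℝ := ∑ t ∈ Finset.Ico (a - 1) (b - 1), |f (t + 1) - f t|

/-- `Acoef r n v j = Σ_{i=j}^n C(r+i-j-1, r-1) v_i` (paper 1-indexed). -/
def Acoef (r n : ℕ) (v : Fin n → ℝ) (jj : ℕ) : ℝ :=
  ∑ i : Fin n, (if jj ≤ i.1 + 1 then ((r + (i.1 + 1) - jj - 1).choose (r - 1) : ℝ) else 0) * v i

/-- The class `C_r({a_i}, {s_i})`. -/
def Cras (r n : ℕ) (a s : ℕ → ℝ) : Set (Fin n → ℝ) :=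
  {θ | (∀ i < r - 1, a i ≤ DD i θ 0 ∧ DD i θ 0 ≤ a i + s i) ∧
    a (r - 1) ≤ DD (r - 1) θ 0 ∧
    (∀ t : ℕ, t + 1 ≤ n - r → DD (r - 1) θ t ≤ DD (r - 1) θ (t + 1)) ∧
    DD (r - 1) θ (n - r) ≤ a (r - 1) + s (r - 1)}

/-- The class `C_r(a, V) = {θ : a ≤ (D^{(r-1)}θ)_1 ≤ ⋯ ≤ (D^{(r-1)}θ)_{n-r+1} ≤ a + V}`. -/
def CrMono (r n : ℕ) (a V : ℝ) : Set (Fin n → ℝ) :=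
  {θ | a ≤ DD (r - 1) θ 0 ∧
    (∀ t : ℕ, t + 1 ≤ n - r → DD (r - 1) θ t ≤ DD (r - 1) θ (t + 1)) ∧
    DD (r - 1) θ (n - r) ≤ a + V}

/-- The forward difference as a linear endomorphism. -/
def dL : Module.End ℝ (ℕ → ℝ) where
  toFun := dseq
  map_add' f g := by funext t; simp [dseq]; ring
  map_smul' c f := by funext t; simp [dseq]; ring

lemma dL_apply (f : ℕ → ℝ) (t : ℕ) : dL f t = f (t + 1) - f t := rfl

lemma dLp_eq (r : ℕ) (f : ℕ → ℝ) : (dL ^ r) f = dseq^[r] f := by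
  rw [Module.End.pow_apply]; rfl

lemma dLp_succ (r : ℕ) (f : ℕ → ℝ) : (dL ^ (r + 1)) f = (dL ^ r) (dL f) := by
  rw [pow_succ]; rfl

lemma dLp_succ' (r : ℕ) (f : ℕ → ℝ) : (dL ^ (r + 1)) f = dL ((dL ^ r) f) := by
  rw [pow_succ']; rfl

lemma dLp_congr (r : ℕ) : ∀ {f g : ℕ → ℝ} (t : ℕ),
    (∀ x, t ≤ x → x ≤ t + r → f x = g x) → (dL ^ r) f t = (dL ^ r) g t := by
  induction r with
  | zero => intro f g t h; simpa using h t le_rfl le_rfl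
  | succ r ih =>
    intro f g t h
    rw [dLp_succ', dLp_succ', dL_apply, dL_apply,
      ih (t + 1) (fun x h1 h2 => h x (by omega) (by omega)),
      ih t (fun x h1 h2 => h x (by omega) (by omega))]

lemma dLp_zero_of (r : ℕ) {f : ℕ → ℝ} (t : ℕ)
    (h : ∀ x, t ≤ x → x ≤ t + r → f x = 0) : (dL ^ r) f t = 0 := by
  have := dLp_congr r (f := f) (g := 0) t (by simpa using h)
  simpa using this

lemma dLp_shift (r : ℕ) : ∀ (f : ℕ → ℝ) (c t : ℕ),
    (dL ^ r) (fun x => f (x + c)) t = (dL ^ r) f (t + c) := by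
  induction r with
  | zero => intro f c t; simp
  | succ r ih =>
    intro f c t
    rw [dLp_succ', dLp_succ', dL_apply, dL_apply, ih, ih]
    rw [add_right_comm]

/-- Summation by parts. -/
lemma sum_by_parts (r : ℕ) : ∀ (N : ℕ) (f q : ℕ → ℝ), (∀ x, x < r → q x = 0) →
    (∀ x, N ≤ x → q x = 0) →
    ∑ t ∈ Finset.range N, q (t + r) * (dL ^ r) f t
      = (-1) ^ r * ∑ i ∈ Finset.range N, f i * (dL ^ r) q i := by
  induction r with
  | zero =>
    intro N f q _ _
    simp [mul_comm]
  | succ r ih =>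
    intro N f q h0 h1
    have e1 := ih N (dL f) (fun x => q (x + 1)) (fun x hx => h0 _ (by omega))
      (fun x hx => h1 _ (by omega))
    rw [dLp_succ]
    have e2 : ∑ t ∈ Finset.range N, q (t + (r + 1)) * (dL ^ r) (dL f) t
        = ∑ t ∈ Finset.range N, (fun x => q (x + 1)) (t + r) * (dL ^ r) (dL f) t := by
      apply Finset.sum_congr rfl
      intro t _
      simp only [add_assoc]
    rw [e2, e1, pow_succ, mul_assoc]
    congr 1
    simp only [dLp_shift]
    rw [neg_one_mul, ← Finset.sum_neg_distrib]
    have e3 : ∀ i, dL f i * (dL ^ r) q (i + 1) - -(f i * (dL ^ (r + 1)) q i)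
        = (fun i => f i * (dL ^ r) q i) (i + 1) - (fun i => f i * (dL ^ r) q i) i := by
      intro i
      rw [dLp_succ', dL_apply, dL_apply]; ring
    rw [← sub_eq_zero, ← Finset.sum_sub_distrib]
    simp only [e3]
    rw [Finset.sum_range_sub (fun i => f i * (dL ^ r) q i)]
    have a1 : (dL ^ r) q N = 0 := dLp_zero_of r N (fun x hx _ => h1 x hx)
    have a2 : (dL ^ r) q 0 = 0 := dLp_zero_of r 0 (fun x _ hx => h0 x (by omega))
    simp [a1, a2]

/-- Sup bound for a function vanishing on `[0,r)` by the `ℓ²` norm of its `r`-th difference. -/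
lemma sup_aux (r : ℕ) (ℓ : ℕ) (B : ℝ) : ∀ (q : ℕ → ℝ), (∀ x, x < r → q x = 0) →
    (∑ i ∈ Finset.range ℓ, |(dL ^ r) q i| ≤ B) → 1 ≤ r →
    ∀ x, x ≤ ℓ → |q x| ≤ (ℓ : ℝ) ^ (r - 1) * B := by
  have key : ∀ (g : ℕ → ℝ), g 0 = 0 → ∀ x, |g x| ≤ ∑ i ∈ Finset.range x, |dL g i| := by
    intro g hg x
    have : g x = ∑ i ∈ Finset.range x, dL g i := by
      simp only [dL_apply]; rw [Finset.sum_range_sub, hg, sub_zero]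
    rw [this]; exact Finset.abs_sum_le_sum_abs _ _
  induction r with
  | zero => intro q _ _ h; omega
  | succ r ih =>
    intro q h0 hB _ x hx
    rcases Nat.eq_zero_or_pos r with hr | hr
    · subst hr
      simp only [zero_add, pow_one, Nat.sub_self, pow_zero, one_mul] at *
      refine (key q (h0 0 (by omega)) x).trans (le_trans ?_ hB)
      exact Finset.sum_le_sum_of_subset_of_nonneg (by simpa using hx) (fun _ _ _ => abs_nonneg _)
    · have h1 : ∀ y, y ≤ ℓ → |dL q y| ≤ (ℓ : ℝ) ^ (r - 1) * B := by
        apply ih (dL q)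
        · intro y hy
          rw [dL_apply, h0 _ (by omega), h0 _ (by omega), sub_zero]
        · rwa [← dLp_succ]
        · exact hr
      have hB0 : 0 ≤ B := le_trans (Finset.sum_nonneg (fun _ _ => abs_nonneg _)) hB
      calc |q x| ≤ ∑ i ∈ Finset.range x, |dL q i| := key q (h0 0 (by omega)) x
        _ ≤ ∑ i ∈ Finset.range x, (ℓ : ℝ) ^ (r - 1) * B :=
            Finset.sum_le_sum (fun i hi => h1 i (by have := Finset.mem_range.1 hi; omega))
        _ = x * ((ℓ : ℝ) ^ (r - 1) * B) := by simp
        _ ≤ ℓ * ((ℓ : ℝ) ^ (r - 1) * B) := by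
            apply mul_le_mul_of_nonneg_right (by exact_mod_cast hx) (by positivity)
        _ = (ℓ : ℝ) ^ (r + 1 - 1) * B := by
            rw [← mul_assoc, ← pow_succ']; congr 2; omega

lemma sup_bound (r : ℕ) (hr : 1 ≤ r) (ℓ : ℕ) (τ : ℝ) (hτ : 0 ≤ τ) (q : ℕ → ℝ)
    (h0 : ∀ x, x < r → q x = 0)
    (hB : ∑ i ∈ Finset.range ℓ, ((dL ^ r) q i) ^ 2 ≤ τ ^ 2) (x : ℕ) (hx : x ≤ ℓ) :
    |q x| ≤ τ * ((ℓ : ℝ) ^ (r - 1) * √ℓ) := by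
  have := sup_aux r ℓ (√ℓ * τ) q h0 ?_ hr x hx
  · refine this.trans (le_of_eq (by ring))
  · have h2 : (∑ i ∈ Finset.range ℓ, |(dL ^ r) q i|) ^ 2 ≤ (√ℓ * τ) ^ 2 := by
      have := sq_sum_le_card_mul_sum_sq (s := Finset.range ℓ) (f := fun i => |(dL ^ r) q i|)
      simp only [Finset.card_range, sq_abs] at this
      rw [mul_pow, Real.sq_sqrt (by positivity)]
      exact this.trans (by gcongr)
    exact (le_abs_self _).trans (abs_le_of_sq_le_sq h2 (by positivity))

/-- Existence of a small function with prescribed `r`-th difference. -/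
lemma exists_antidiff (n : ℕ) (a : ℕ → ℝ) :
    ∀ m, ∃ g : ℕ → ℝ, (∀ t, (dL ^ (m + 1)) g t = a t) ∧
      ∀ i, i ≤ n → |g i| ≤ (n : ℝ) ^ m * ∑ t ∈ Finset.range n, |a t| := by
  intro m
  have hd : ∀ f : ℕ → ℝ, dL (fun i => ∑ t ∈ Finset.range i, f t) = f := by
    intro f; funext t; rw [dL_apply, Finset.sum_range_succ]; ring
  induction m with
  | zero =>
    refine ⟨fun i => ∑ t ∈ Finset.range i, a t, ?_, ?_⟩
    · intro t; simp [hd]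
    · intro i hi
      simp only [pow_zero, one_mul]
      refine (Finset.abs_sum_le_sum_abs _ _).trans ?_
      exact Finset.sum_le_sum_of_subset_of_nonneg (by simpa using hi) (fun _ _ _ => abs_nonneg _)
  | succ m ih =>
    obtain ⟨g, hg, hb⟩ := ih
    refine ⟨fun i => ∑ t ∈ Finset.range i, g t, ?_, ?_⟩
    · intro t; rw [dLp_succ, hd, hg]
    · intro i hi
      set B := ∑ t ∈ Finset.range n, |a t|
      have hB : 0 ≤ B := Finset.sum_nonneg (fun _ _ => abs_nonneg _)
      calc |∑ t ∈ Finset.range i, g t| ≤ ∑ t ∈ Finset.range i, |g t| :=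
            Finset.abs_sum_le_sum_abs _ _
        _ ≤ ∑ t ∈ Finset.range i, (n : ℝ) ^ m * B :=
            Finset.sum_le_sum (fun t ht => hb t (by have := Finset.mem_range.1 ht; omega))
        _ = i * ((n : ℝ) ^ m * B) := by simp
        _ ≤ n * ((n : ℝ) ^ m * B) := by
            apply mul_le_mul_of_nonneg_right (by exact_mod_cast hi) (by positivity)
        _ = (n : ℝ) ^ (m + 1) * B := by rw [pow_succ]; ring

lemma dLp_single (r i : ℕ) : (dL ^ r) (Pi.single i (1 : ℝ)) i = (-1) ^ r := by
  induction r with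
  | zero => simp
  | succ r ih =>
    rw [dLp_succ', dL_apply, ih, dLp_zero_of r (i + 1), pow_succ]
    · ring
    · intro x hx _
      exact Pi.single_eq_of_ne (by omega) _

/-- Functions supported on `[r, ℓ)`. -/
def supSub (r ℓ : ℕ) : Submodule ℝ (ℕ → ℝ) where
  carrier := {Q | ∀ x, (x < r ∨ ℓ ≤ x) → Q x = 0}
  add_mem' := by intro a b ha hb x hx; simp [ha x hx, hb x hx]
  zero_mem' := by intro x _; rfl
  smul_mem' := by intro c a ha x hx; simp [ha x hx]

/-- Restriction to `[0,ℓ)`. -/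
def resL (ℓ : ℕ) : (ℕ → ℝ) →ₗ[ℝ] EuclideanSpace ℝ (Fin ℓ) where
  toFun f := WithLp.toLp 2 (fun i => f i)
  map_add' f g := by ext i; simp
  map_smul' c f := by ext i; simp

lemma resL_apply (ℓ : ℕ) (f : ℕ → ℝ) (i : Fin ℓ) : resL ℓ f i = f i := rfl

/-- The space of `r`-th differences. -/
def difSub (r ℓ : ℕ) : Submodule ℝ (EuclideanSpace ℝ (Fin ℓ)) :=
  (supSub r ℓ).map ((resL ℓ).comp (dL ^ r))

lemma euc_inner (ℓ : ℕ) (v w : EuclideanSpace ℝ (Fin ℓ)) : inner ℝ v w = ∑ i, v i * w i := by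
  rw [PiLp.inner_apply]
  apply Finset.sum_congr rfl
  intro i _
  simp [mul_comm]

lemma finrank_orth (r ℓ : ℕ) : Module.finrank ℝ (difSub r ℓ)ᗮ ≤ r := by
  let φ : (difSub r ℓ)ᗮ →ₗ[ℝ] (Fin r → ℝ) :=
    { toFun := fun v b => if h : b.1 < ℓ then v.1 ⟨b.1, h⟩ else 0
      map_add' := by intro v w; funext b; by_cases h : b.1 < ℓ <;> simp [h]
      map_smul' := by intro c w; funext b; by_cases h : b.1 < ℓ <;> simp [h] }
  have hinj : Function.Injective φ := by
    rw [← LinearMap.ker_eq_bot, LinearMap.ker_eq_bot']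
    intro v hv
    have hz : ∀ i : ℕ, ∀ h : i < ℓ, v.1 ⟨i, h⟩ = 0 := by
      intro i
      induction i using Nat.strong_induction_on with
      | _ i ih =>
        intro h
        by_cases hir : i < r
        · have := congrFun hv ⟨i, hir⟩
          simpa [φ, h] using this
        · have hm : resL ℓ ((dL ^ r) (Pi.single i (1 : ℝ))) ∈ difSub r ℓ := by
            refine Submodule.mem_map.2 ⟨Pi.single i 1, ?_, rfl⟩
            intro x hx
            exact Pi.single_eq_of_ne (by omega) _
          have h0 := (Submodule.mem_orthogonal _ _).1 v.2 _ hm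
          rw [euc_inner, Finset.sum_eq_single ⟨i, h⟩] at h0
          · rw [resL_apply, dLp_single] at h0
            exact (mul_eq_zero.1 h0).resolve_left (pow_ne_zero _ (by norm_num))
          · intro j _ hj
            have hj' : j.1 ≠ i := fun h' => hj (Fin.ext h')
            rcases lt_or_gt_of_ne hj' with hlt | hgt
            · rw [ih j.1 hlt j.2, mul_zero]
            · rw [resL_apply, dLp_zero_of r, zero_mul]
              intro x hx _
              exact Pi.single_eq_of_ne (by omega) _
          · intro h'; exact absurd (Finset.mem_univ _) h'
    ext i
    exact hz i.1 i.2
  have := LinearMap.finrank_le_finrank_of_injective hinj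
  simpa using this

lemma proj_lemma (r ℓ : ℕ) : ∃ e : Fin r → ℕ → ℝ,
    (∀ b, ∑ i ∈ Finset.range ℓ, e b i ^ 2 ≤ 1) ∧
    ∀ z : ℕ → ℝ, ∃ A ∈ supSub r ℓ,
      (∀ Q ∈ supSub r ℓ, ∑ i ∈ Finset.range ℓ, (z i - (dL ^ r) A i) * (dL ^ r) Q i = 0) ∧
      ∑ i ∈ Finset.range ℓ, (z i - (dL ^ r) A i) ^ 2
        ≤ ∑ b, (∑ i ∈ Finset.range ℓ, e b i * z i) ^ 2 := by
  set S := difSub r ℓ with hS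
  set B := stdOrthonormalBasis ℝ Sᗮ with hB
  set d := Module.finrank ℝ Sᗮ with hd
  have hdr : d ≤ r := finrank_orth r ℓ
  refine ⟨fun b i => if h : b.1 < d then (if h' : i < ℓ then (B ⟨b.1, h⟩).1 ⟨i, h'⟩ else 0) else 0,
    ?_, ?_⟩
  · intro b
    by_cases h : b.1 < d
    · simp only [h, dite_true]
      rw [Finset.sum_range]
      simp only [Fin.is_lt, dite_true, Fin.eta]
      have h1 : ‖B ⟨b.1, h⟩‖ = 1 := B.orthonormal.1 _
      have h2 : ‖(B ⟨b.1, h⟩).1‖ ^ 2 = 1 := by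
        have : ‖(B ⟨b.1, h⟩).1‖ = 1 := h1
        rw [this]; norm_num
      rw [EuclideanSpace.norm_sq_eq] at h2
      simp only [Real.norm_eq_abs, sq_abs] at h2
      exact h2.le
    · simp [h]
  · intro z
    set Z := resL ℓ z with hZ
    have hp1 : Sᗮ.starProjection Z ∈ Sᗮ := Submodule.starProjection_apply_mem _ _
    have hp2 : Z - Sᗮ.starProjection Z ∈ S := by
      have := Submodule.sub_starProjection_mem_orthogonal (K := Sᗮ) Z
      rwa [Submodule.orthogonal_orthogonal] at this
    obtain ⟨A, hA, hAe⟩ := Submodule.mem_map.1 hp2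
    have hpe : ∀ i : Fin ℓ, z i - (dL ^ r) A i = Sᗮ.starProjection Z i := by
      intro i
      have := congrArg (fun v : EuclideanSpace ℝ (Fin ℓ) => v i) hAe
      simp only [LinearMap.comp_apply, resL_apply, PiLp.sub_apply, hZ] at this
      rw [this, hZ]; ring
    refine ⟨A, hA, ?_, ?_⟩
    · intro Q hQ
      rw [Finset.sum_range]
      simp only [hpe]
      have hm : resL ℓ ((dL ^ r) Q) ∈ S := Submodule.mem_map.2 ⟨Q, hQ, rfl⟩
      have h0 := (Submodule.mem_orthogonal _ _).1 hp1 _ hm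
      rw [euc_inner] at h0
      rw [← h0]
      exact Finset.sum_congr rfl (fun i _ => by rw [resL_apply, mul_comm])
    · rw [Finset.sum_range]
      simp only [hpe]
      have h1 : ∑ i, (Sᗮ.starProjection Z i) ^ 2 = ‖Sᗮ.starProjection Z‖ ^ 2 := by
        rw [EuclideanSpace.norm_sq_eq]; simp
      rw [h1]
      have h2 := B.sum_sq_norm_inner_right ⟨_, hp1⟩
      have h3 : ∀ a : Fin d, inner ℝ (B a) ⟨_, hp1⟩ = ∑ i ∈ Finset.range ℓ,
          (if h' : i < ℓ then (B a).1 ⟨i, h'⟩ else 0) * z i := by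
        intro a
        rw [Finset.sum_range]
        simp only [Fin.is_lt, dite_true, Fin.eta]
        have h4 : inner ℝ (B a).1 (Z - Sᗮ.starProjection Z) = 0 :=
          (Submodule.mem_orthogonal' _ _).1 (B a).2 _ hp2
        rw [inner_sub_right, sub_eq_zero] at h4
        rw [Submodule.coe_inner, ← h4, euc_inner]
        rfl
      have h5 : ‖Sᗮ.starProjection Z‖ ^ 2 = ∑ a : Fin d, (∑ i ∈ Finset.range ℓ,
          (if h' : i < ℓ then (B a).1 ⟨i, h'⟩ else 0) * z i) ^ 2 := by
        rw [show ‖Sᗮ.starProjection Z‖ = ‖(⟨_, hp1⟩ : Sᗮ)‖ from rfl, ← h2]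
        simp only [h3, Real.norm_eq_abs, sq_abs]
      rw [h5]
      set G : ℕ → ℝ := fun b => if h : b < d then (∑ i ∈ Finset.range ℓ,
          (if h' : i < ℓ then (B ⟨b, h⟩).1 ⟨i, h'⟩ else 0) * z i) ^ 2 else 0 with hG
      have h6 : ∑ a : Fin d, (∑ i ∈ Finset.range ℓ,
          (if h' : i < ℓ then (B a).1 ⟨i, h'⟩ else 0) * z i) ^ 2 = ∑ b ∈ Finset.range d, G b := by
        rw [Finset.sum_range]
        apply Finset.sum_congr rfl
        intro a _
        simp only [hG, a.2, dite_true, Fin.eta]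
      rw [h6]
      have h7 : ∀ b : Fin r, (∑ i ∈ Finset.range ℓ, (if h : b.1 < d then
          (if h' : i < ℓ then (B ⟨b.1, h⟩).1 ⟨i, h'⟩ else 0) else 0) * z i) ^ 2 = G b := by
        intro b
        by_cases h : b.1 < d
        · simp [hG, h]
        · simp [hG, h]
      simp only [h7]
      rw [← Finset.sum_range]
      apply Finset.sum_le_sum_of_subset_of_nonneg
      · simpa using hdr
      · intro b _ _
        simp only [hG]
        split_ifs
        · positivity
        · exact le_rfl

/-- Integrable with integral at most `C`. -/
def BddE (n : ℕ) (σ : ℝ) (f : (Fin n → ℝ) → ℝ) (C : ℝ) : Prop :=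
  Integrable f (gaussVec n σ) ∧ ∫ ξ, f ξ ∂gaussVec n σ ≤ C

/-- Normalized shifted noise. -/
def zt (r : ℕ) {n : ℕ} (σ : ℝ) (ξ : Fin n → ℝ) (α : ℕ) : ℕ → ℝ :=
  fun i => (-1) ^ r / σ * pad ξ (i + α)

lemma BddE.add {n : ℕ} {σ : ℝ} {f g : (Fin n → ℝ) → ℝ} {A B : ℝ} (hf : BddE n σ f A)
    (hg : BddE n σ g B) : BddE n σ (fun ξ => f ξ + g ξ) (A + B) :=
  ⟨hf.1.add hg.1, by rw [integral_add hf.1 hg.1]; exact add_le_add hf.2 hg.2⟩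

lemma BddE.mul {n : ℕ} {σ : ℝ} {f : (Fin n → ℝ) → ℝ} {A c : ℝ} (hc : 0 ≤ c) (hf : BddE n σ f A) :
    BddE n σ (fun ξ => c * f ξ) (c * A) :=
  ⟨hf.1.const_mul c, by rw [integral_const_mul]; exact mul_le_mul_of_nonneg_left hf.2 hc⟩

lemma BddE.sum {n : ℕ} {σ : ℝ} {ι : Type*} (s : Finset ι) {f : ι → (Fin n → ℝ) → ℝ} {A : ι → ℝ}
    (hf : ∀ i ∈ s, BddE n σ (f i) (A i)) :
    BddE n σ (fun ξ => ∑ i ∈ s, f i ξ) (∑ i ∈ s, A i) :=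
  ⟨integrable_finsetSum _ (fun i hi => (hf i hi).1), by
    rw [integral_finsetSum _ (fun i hi => (hf i hi).1)]
    exact Finset.sum_le_sum (fun i hi => (hf i hi).2)⟩

instance (n : ℕ) (σ : ℝ) : IsProbabilityMeasure (gaussVec n σ) := by
  unfold gaussVec; infer_instance

lemma BddE.const (n : ℕ) (σ : ℝ) (A : ℝ) : BddE n σ (fun _ => A) A :=
  ⟨integrable_const _, by simp⟩

lemma exp_lin (n : ℕ) (σ : ℝ) (c : Fin n → ℝ) :
    Integrable (fun ξ : Fin n → ℝ => Real.exp (∑ i, c i * ξ i)) (gaussVec n σ) ∧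
    ∫ ξ, Real.exp (∑ i, c i * ξ i) ∂gaussVec n σ = Real.exp (σ ^ 2 * (∑ i, c i ^ 2) / 2) := by
  have h : (fun ξ : Fin n → ℝ => Real.exp (∑ i, c i * ξ i))
      = fun ξ => ∏ i, (fun (i : Fin n) (x : ℝ) => Real.exp (c i * x)) i (ξ i) := by
    funext ξ; rw [Real.exp_sum]
  constructor
  · rw [h]
    exact Integrable.fintype_prod (fun i => integrable_exp_mul_gaussianReal (c i))
  · rw [h]
    unfold gaussVec
    rw [integral_fintype_prod_eq_prod (𝕜 := ℝ) (E := fun _ => ℝ) (fun (i : Fin n) (x : ℝ) => Real.exp (c i * x))]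
    have h1 : ∀ i : Fin n, ∫ x, Real.exp (c i * x) ∂gaussianReal 0 (σ ^ 2).toNNReal
        = Real.exp (σ ^ 2 * c i ^ 2 / 2) := by
      intro i
      have := mgf_gaussianReal (p := gaussianReal 0 (σ ^ 2).toNNReal) (X := id) (μ := 0)
        (v := (σ ^ 2).toNNReal) (by simp) (c i)
      simp only [mgf, id] at this
      rw [this, Real.coe_toNNReal _ (sq_nonneg _)]
      ring_nf
    simp only [h1]
    rw [← Real.exp_sum]
    congr 1
    rw [Finset.mul_sum, Finset.sum_div]

lemma shift_sum (n ℓ α : ℕ) (G : ℕ → ℝ) :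
    ∑ j : Fin n, (if α ≤ j.1 ∧ j.1 < ℓ + α then G (j.1 - α) else 0)
      = ∑ i ∈ Finset.range ℓ, if i + α < n then G i else 0 := by
  rw [← Finset.sum_range (fun j => if α ≤ j ∧ j < ℓ + α then G (j - α) else 0),
    ← Finset.sum_filter, ← Finset.sum_filter]
  refine Finset.sum_bij' (fun j _ => j - α) (fun i _ => i + α) ?_ ?_ ?_ ?_ ?_
  · intro j hj; simp at hj ⊢; omega
  · intro j hj; simp at hj ⊢; omega
  · intro j hj; simp at hj ⊢; omega
  · intro j hj; simp at hj ⊢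
  · intro j hj; rfl

lemma cosh_bdd (r n : ℕ) (σ : ℝ) (hσ : 0 < σ) (ℓ α : ℕ) (e : ℕ → ℝ)
    (he : ∑ i ∈ Finset.range ℓ, e i ^ 2 ≤ 1) :
    BddE n σ (fun ξ => Real.cosh (∑ i ∈ Finset.range ℓ, e i * zt r σ ξ α i)) 2 := by
  set κ : ℝ := (-1) ^ r / σ with hκ
  have hκ2 : σ ^ 2 * κ ^ 2 = 1 := by
    rw [hκ, div_pow, ← pow_mul, mul_comm r 2, pow_mul]; field_simp; simp
  set c : Fin n → ℝ := fun j => if α ≤ j.1 ∧ j.1 < ℓ + α then κ * e (j.1 - α) else 0 with hc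
  have hlin : ∀ ξ : Fin n → ℝ, ∑ i ∈ Finset.range ℓ, e i * zt r σ ξ α i = ∑ j, c j * ξ j := by
    intro ξ
    have := shift_sum n ℓ α (fun i => κ * e i * pad ξ (i + α))
    have h2 : ∀ j : Fin n, c j * ξ j = if α ≤ j.1 ∧ j.1 < ℓ + α then
        κ * e (j.1 - α) * pad ξ (j.1 - α + α) else 0 := by
      intro j
      simp only [hc]
      split_ifs with h
      · rw [Nat.sub_add_cancel h.1]; simp [pad]
      · simp
    simp only [h2]
    rw [this]
    apply Finset.sum_congr rfl
    intro i _
    split_ifs with h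
    · simp only [zt]; ring
    · simp [zt, pad, h]
  have hsq : σ ^ 2 * ∑ j, c j ^ 2 ≤ 1 := by
    have := shift_sum n ℓ α (fun i => κ ^ 2 * e i ^ 2)
    have h2 : ∀ j : Fin n, c j ^ 2 = if α ≤ j.1 ∧ j.1 < ℓ + α then
        κ ^ 2 * e (j.1 - α) ^ 2 else 0 := by
      intro j
      simp only [hc]
      split_ifs with h
      · ring
      · simp
    simp only [h2]
    rw [this]
    calc σ ^ 2 * ∑ i ∈ Finset.range ℓ, (if i + α < n then κ ^ 2 * e i ^ 2 else 0)
        ≤ σ ^ 2 * ∑ i ∈ Finset.range ℓ, κ ^ 2 * e i ^ 2 := by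
          apply mul_le_mul_of_nonneg_left _ (sq_nonneg _)
          apply Finset.sum_le_sum
          intro i _
          split_ifs
          · exact le_rfl
          · positivity
      _ = ∑ i ∈ Finset.range ℓ, e i ^ 2 := by rw [← Finset.mul_sum, ← mul_assoc, hκ2, one_mul]
      _ ≤ 1 := he
  simp only [hlin]
  have h1 := exp_lin n σ c
  have h2 := exp_lin n σ (fun j => - c j)
  simp only [neg_mul, Finset.sum_neg_distrib, neg_sq] at h2
  have hexp : Real.exp (σ ^ 2 * (∑ i, c i ^ 2) / 2) ≤ 2 := by
    have : Real.exp (σ ^ 2 * (∑ i, c i ^ 2) / 2) ≤ Real.exp (1 / 2) :=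
      Real.exp_le_exp.2 (by linarith)
    refine this.trans ?_
    have h3 : Real.exp (1 / 2) ^ 2 ≤ 2 ^ 2 := by
      rw [← Real.exp_nat_mul]; norm_num
      linarith [Real.exp_one_lt_d9]
    exact (abs_le_of_sq_le_sq h3 (by norm_num)).trans' (le_abs_self _)
  have hB1 : BddE n σ (fun ξ => Real.exp (∑ i, c i * ξ i)) 2 := ⟨h1.1, h1.2 ▸ hexp⟩
  have hB2 : BddE n σ (fun ξ => Real.exp (-∑ i, c i * ξ i)) 2 := ⟨h2.1, h2.2 ▸ hexp⟩
  have := (hB1.add hB2).mul (c := 1 / 2) (by norm_num)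
  convert this using 1
  · funext ξ; rw [Real.cosh_eq]; ring
  · norm_num

lemma pow_le_cosh (m : ℕ) (x : ℝ) : x ^ (2 * m) / (2 * m).factorial ≤ Real.cosh x := by
  refine le_hasSum (Real.hasSum_cosh x) m ?_
  intro j _
  rw [pow_mul]
  positivity

lemma sq_le_cosh (x : ℝ) : x ^ 2 ≤ 2 * Real.cosh x := by
  have := pow_le_cosh 1 x
  norm_num [Nat.factorial] at this
  linarith

lemma six_le_cosh (x : ℝ) : x ^ 6 ≤ 720 * Real.cosh x := by
  have := pow_le_cosh 3 x
  norm_num [Nat.factorial] at this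
  linarith

/-- Directions spanning the orthogonal complement of the differences on a cell. -/
def pe (r ℓ : ℕ) : Fin r → ℕ → ℝ := (proj_lemma r ℓ).choose

/-- The potential of the projection. -/
def pA (r ℓ : ℕ) (z : ℕ → ℝ) : ℕ → ℝ := ((proj_lemma r ℓ).choose_spec.2 z).choose

/-- Sum of squares of the coefficients. -/
def Nn (r ℓ : ℕ) (z : ℕ → ℝ) : ℝ := ∑ b, (∑ i ∈ Finset.range ℓ, pe r ℓ b i * z i) ^ 2

/-- Sum of the cosh of the coefficients. -/
def Nc (r ℓ : ℕ) (z : ℕ → ℝ) : ℝ := ∑ b, Real.cosh (∑ i ∈ Finset.range ℓ, pe r ℓ b i * z i)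

lemma pe_sq (r ℓ : ℕ) (b : Fin r) : ∑ i ∈ Finset.range ℓ, pe r ℓ b i ^ 2 ≤ 1 :=
  (proj_lemma r ℓ).choose_spec.1 b

lemma pA_mem (r ℓ : ℕ) (z : ℕ → ℝ) : pA r ℓ z ∈ supSub r ℓ :=
  ((proj_lemma r ℓ).choose_spec.2 z).choose_spec.1

lemma pA_orth (r ℓ : ℕ) (z : ℕ → ℝ) (Q : ℕ → ℝ) (hQ : Q ∈ supSub r ℓ) :
    ∑ i ∈ Finset.range ℓ, (z i - (dL ^ r) (pA r ℓ z) i) * (dL ^ r) Q i = 0 :=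
  ((proj_lemma r ℓ).choose_spec.2 z).choose_spec.2.1 Q hQ

lemma pA_res (r ℓ : ℕ) (z : ℕ → ℝ) :
    ∑ i ∈ Finset.range ℓ, (z i - (dL ^ r) (pA r ℓ z) i) ^ 2 ≤ Nn r ℓ z :=
  ((proj_lemma r ℓ).choose_spec.2 z).choose_spec.2.2

lemma Nn_nonneg (r ℓ : ℕ) (z : ℕ → ℝ) : 0 ≤ Nn r ℓ z :=
  Finset.sum_nonneg (fun _ _ => sq_nonneg _)

lemma Nc_nonneg (r ℓ : ℕ) (z : ℕ → ℝ) : 0 ≤ Nc r ℓ z :=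
  Finset.sum_nonneg (fun _ _ => (Real.cosh_pos _).le)

lemma Nn_le (r ℓ : ℕ) (z : ℕ → ℝ) : Nn r ℓ z ≤ 2 * Nc r ℓ z := by
  unfold Nn Nc
  rw [Finset.mul_sum]
  exact Finset.sum_le_sum (fun b _ => sq_le_cosh _)

lemma Nn_cube (r ℓ : ℕ) (hr : 1 ≤ r) (z : ℕ → ℝ) :
    Nn r ℓ z ^ 3 ≤ (r : ℝ) ^ 2 * 720 * Nc r ℓ z := by
  have h := pow_sum_div_card_le_sum_pow (s := Finset.univ)
    (f := fun b : Fin r => (∑ i ∈ Finset.range ℓ, pe r ℓ b i * z i) ^ 2)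
    (fun _ _ => sq_nonneg _) 2
  simp only [Finset.card_univ, Fintype.card_fin] at h
  have hr' : (0 : ℝ) < (r : ℝ) ^ 2 := by positivity
  rw [div_le_iff₀ hr'] at h
  have h2 : ∑ b : Fin r, ((∑ i ∈ Finset.range ℓ, pe r ℓ b i * z i) ^ 2) ^ (2 + 1)
      ≤ 720 * Nc r ℓ z := by
    unfold Nc
    rw [Finset.mul_sum]
    refine Finset.sum_le_sum (fun b _ => ?_)
    rw [← pow_mul]
    exact six_le_cosh _
  unfold Nn
  calc _ ≤ _ := h
    _ ≤ (720 * Nc r ℓ z) * (r : ℝ) ^ 2 := mul_le_mul_of_nonneg_right h2 hr'.le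
    _ = _ := by ring

lemma Nc_bdd (r n : ℕ) (σ : ℝ) (hσ : 0 < σ) (ℓ α : ℕ) :
    BddE n σ (fun ξ => Nc r ℓ (zt r σ ξ α)) (2 * r) := by
  have := BddE.sum (n := n) (σ := σ) (Finset.univ : Finset (Fin r))
    (f := fun b ξ => Real.cosh (∑ i ∈ Finset.range ℓ, pe r ℓ b i * zt r σ ξ α i))
    (A := fun _ => 2) (fun b _ => cosh_bdd r n σ hσ ℓ α _ (pe_sq r ℓ b))
  refine ⟨this.1, this.2.trans ?_⟩
  simp [mul_comm]

/-- Shift to the right. -/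
def shR (L : ℕ) (f : ℕ → ℝ) : ℕ → ℝ := fun x => if x < L then 0 else f (x - L)

lemma shR_add (L : ℕ) (f g : ℕ → ℝ) : shR L (f + g) = shR L f + shR L g := by
  funext x; simp only [shR, Pi.add_apply]; split_ifs <;> simp

lemma shR_sub (L : ℕ) (f g : ℕ → ℝ) : shR L (f - g) = shR L f - shR L g := by
  funext x; simp only [shR, Pi.sub_apply]; split_ifs <;> simp

lemma shR_dL_hi (r L : ℕ) (f : ℕ → ℝ) (i : ℕ) : (dL ^ r) (shR L f) (i + L) = (dL ^ r) f i := by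
  rw [← dLp_shift]
  have : (fun x => shR L f (x + L)) = f := by funext x; simp [shR]
  rw [this]

lemma shR_dL_lo (r L : ℕ) (f : ℕ → ℝ) (hf : ∀ x < r, f x = 0) (i : ℕ) (hi : i < L) :
    (dL ^ r) (shR L f) i = 0 := by
  apply dLp_zero_of
  intro x _ hx
  simp only [shR]
  split_ifs with h
  · rfl
  · apply hf; omega

lemma supSub_lo {r ℓ : ℕ} {Q : ℕ → ℝ} (h : Q ∈ supSub r ℓ) (x : ℕ) (hx : x < r) : Q x = 0 :=
  h x (Or.inl hx)

lemma supSub_hi {r ℓ : ℕ} {Q : ℕ → ℝ} (h : Q ∈ supSub r ℓ) (x : ℕ) (hx : ℓ ≤ x) : Q x = 0 :=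
  h x (Or.inr hx)

lemma supSub_dL_hi {r ℓ : ℕ} {Q : ℕ → ℝ} (h : Q ∈ supSub r ℓ) (i : ℕ) (hi : ℓ ≤ i) :
    (dL ^ r) Q i = 0 :=
  dLp_zero_of _ _ (fun x hx _ => supSub_hi h x (by omega))

lemma supSub_mono {r ℓ ℓ' : ℕ} (hl : ℓ ≤ ℓ') {Q : ℕ → ℝ} (h : Q ∈ supSub r ℓ) :
    Q ∈ supSub r ℓ' := fun x hx => h x (by omega)

lemma shR_mem {r L : ℕ} {Q : ℕ → ℝ} (h : Q ∈ supSub r L) : shR L Q ∈ supSub r (L + L) := by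
  intro x hx
  simp only [shR]
  split_ifs with h1
  · rfl
  · exact h _ (by omega)

/-- Orthogonal decomposition of a doubled cell. -/
lemma split_lemma (r L : ℕ) (z Q1 Q2 : ℕ → ℝ) (hQ1 : Q1 ∈ supSub r L) (hQ2 : Q2 ∈ supSub r L) :
    ∃ d ∈ supSub r (L + L),
      d = pA r (L + L) z - pA r L z - shR L (pA r L (fun i => z (i + L))) ∧
      ∑ i ∈ Finset.range (L + L), ((dL ^ r) d i) ^ 2 ≤ Nn r L z + Nn r L (fun i => z (i + L)) ∧
      ∑ i ∈ Finset.range (L + L), ((dL ^ r) (pA r (L + L) z) i - (dL ^ r) (Q1 + shR L Q2) i) ^ 2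
        = ∑ i ∈ Finset.range (L + L), ((dL ^ r) d i) ^ 2
          + ∑ i ∈ Finset.range L, ((dL ^ r) (pA r L z) i - (dL ^ r) Q1 i) ^ 2
          + ∑ i ∈ Finset.range L, ((dL ^ r) (pA r L (fun i => z (i + L))) i - (dL ^ r) Q2 i) ^ 2 ∧
      ∑ i ∈ Finset.range (L + L), ((dL ^ r) (pA r (L + L) z) i
          - (dL ^ r) (Q1 + shR L Q2 + d) i) ^ 2
        = ∑ i ∈ Finset.range L, ((dL ^ r) (pA r L z) i - (dL ^ r) Q1 i) ^ 2
          + ∑ i ∈ Finset.range L, ((dL ^ r) (pA r L (fun i => z (i + L))) i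
            - (dL ^ r) Q2 i) ^ 2 := by
  set z' : ℕ → ℝ := fun i => z (i + L) with hz'
  set A := pA r (L + L) z with hA
  set A1 := pA r L z with hA1
  set A2 := pA r L z' with hA2
  have mA : A ∈ supSub r (L + L) := pA_mem _ _ _
  have mA1 : A1 ∈ supSub r L := pA_mem _ _ _
  have mA2 : A2 ∈ supSub r L := pA_mem _ _ _
  have mA1' : A1 ∈ supSub r (L + L) := supSub_mono (by omega) mA1
  have md : A - A1 - shR L A2 ∈ supSub r (L + L) :=
    Submodule.sub_mem _ (Submodule.sub_mem _ mA mA1') (shR_mem mA2)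
  have hsplit : ∀ f : ℕ → ℝ, ∑ i ∈ Finset.range (L + L), f i
      = ∑ i ∈ Finset.range L, f i + ∑ i ∈ Finset.range L, f (i + L) := by
    intro f
    rw [Finset.sum_range_add]
    congr 1
    apply Finset.sum_congr rfl; intro i _; rw [add_comm]
  have dlo : ∀ i ∈ Finset.range L, (dL ^ r) (A - A1 - shR L A2) i
      = (dL ^ r) A i - (dL ^ r) A1 i := by
    intro i hi
    rw [map_sub, map_sub, Pi.sub_apply, Pi.sub_apply,
      shR_dL_lo r L A2 (supSub_lo mA2) i (Finset.mem_range.1 hi), sub_zero]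
  have dhi : ∀ i, (dL ^ r) (A - A1 - shR L A2) (i + L)
      = (dL ^ r) A (i + L) - (dL ^ r) A2 i := by
    intro i
    rw [map_sub, map_sub, Pi.sub_apply, Pi.sub_apply, shR_dL_hi,
      supSub_dL_hi mA1 (i + L) (by omega), sub_zero]
  have qlo : ∀ i ∈ Finset.range L, (dL ^ r) (Q1 + shR L Q2) i = (dL ^ r) Q1 i := by
    intro i hi
    rw [map_add, Pi.add_apply, shR_dL_lo r L Q2 (supSub_lo hQ2) i (Finset.mem_range.1 hi),
      add_zero]
  have qhi : ∀ i, (dL ^ r) (Q1 + shR L Q2) (i + L) = (dL ^ r) Q2 i := by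
    intro i
    rw [map_add, Pi.add_apply, shR_dL_hi, supSub_dL_hi hQ1 (i + L) (by omega), zero_add]
  set d := A - A1 - shR L A2 with hd
  -- orthogonality facts
  have o1 := pA_orth r L z (A1 - Q1) (Submodule.sub_mem _ mA1 hQ1)
  have o2 := pA_orth r L z' (A2 - Q2) (Submodule.sub_mem _ mA2 hQ2)
  have oa := pA_orth r (L + L) z (A1 - Q1) (supSub_mono (by omega) (Submodule.sub_mem _ mA1 hQ1))
  have ob := pA_orth r (L + L) z (shR L (A2 - Q2)) (shR_mem (Submodule.sub_mem _ mA2 hQ2))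
  have oc := pA_orth r (L + L) z d md
  rw [← hA1] at o1
  rw [← hA2] at o2
  rw [← hA] at oa ob oc
  rw [hsplit] at oa ob oc
  have oa' : ∑ i ∈ Finset.range L, (z i - (dL ^ r) A i) * (dL ^ r) (A1 - Q1) i = 0 := by
    have : ∑ i ∈ Finset.range L, (z (i + L) - (dL ^ r) A (i + L)) * (dL ^ r) (A1 - Q1) (i + L) = 0 :=
      Finset.sum_eq_zero (fun i _ => by
        rw [supSub_dL_hi (Submodule.sub_mem _ mA1 hQ1) (i + L) (by omega), mul_zero])
    linarith
  have ob' : ∑ i ∈ Finset.range L, (z' i - (dL ^ r) A (i + L)) * (dL ^ r) (A2 - Q2) i = 0 := by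
    have : ∑ i ∈ Finset.range L, (z i - (dL ^ r) A i) * (dL ^ r) (shR L (A2 - Q2)) i = 0 :=
      Finset.sum_eq_zero (fun i hi => by
        rw [shR_dL_lo r L _ (supSub_lo (Submodule.sub_mem _ mA2 hQ2)) i (Finset.mem_range.1 hi),
          mul_zero])
    simp only [shR_dL_hi] at ob
    linarith
  have c1 : ∑ i ∈ Finset.range L, (dL ^ r) d i * ((dL ^ r) A1 i - (dL ^ r) Q1 i) = 0 := by
    rw [← sub_eq_zero.2 (o1.trans oa'.symm), ← Finset.sum_sub_distrib]
    apply Finset.sum_congr rfl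
    intro i hi
    rw [dlo i hi, map_sub, Pi.sub_apply]; ring
  have c2 : ∑ i ∈ Finset.range L, (dL ^ r) d (i + L) * ((dL ^ r) A2 i - (dL ^ r) Q2 i) = 0 := by
    rw [← sub_eq_zero.2 (o2.trans ob'.symm), ← Finset.sum_sub_distrib]
    apply Finset.sum_congr rfl
    intro i hi
    rw [dhi i, map_sub, Pi.sub_apply]; ring
  refine ⟨d, md, rfl, ?_, ?_, ?_⟩
  · have r1 := pA_res r L z
    have r2 := pA_res r L z'
    rw [← hA1] at r1
    rw [← hA2] at r2
    rw [hsplit]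
    have e1 : ∑ i ∈ Finset.range L, ((dL ^ r) d i) ^ 2
        ≤ ∑ i ∈ Finset.range L, (z i - (dL ^ r) A1 i) ^ 2
          - 2 * ∑ i ∈ Finset.range L, (z i - (dL ^ r) A i) * (dL ^ r) d i := by
      rw [Finset.mul_sum, ← Finset.sum_sub_distrib]
      refine Finset.sum_le_sum (fun i hi => ?_)
      have := dlo i hi
      have h3 : z i - (dL ^ r) A1 i = (z i - (dL ^ r) A i) + (dL ^ r) d i := by rw [this]; ring
      rw [h3]; nlinarith [sq_nonneg (z i - (dL ^ r) A i)]
    have e2 : ∑ i ∈ Finset.range L, ((dL ^ r) d (i + L)) ^ 2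
        ≤ ∑ i ∈ Finset.range L, (z' i - (dL ^ r) A2 i) ^ 2
          - 2 * ∑ i ∈ Finset.range L, (z (i + L) - (dL ^ r) A (i + L)) * (dL ^ r) d (i + L) := by
      rw [Finset.mul_sum, ← Finset.sum_sub_distrib]
      refine Finset.sum_le_sum (fun i hi => ?_)
      have := dhi i
      have h3 : z' i - (dL ^ r) A2 i = (z (i + L) - (dL ^ r) A (i + L)) + (dL ^ r) d (i + L) := by
        rw [this]; ring
      rw [h3]; nlinarith [sq_nonneg (z (i + L) - (dL ^ r) A (i + L))]
    linarith
  · rw [hsplit, hsplit]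
    have e1 : ∑ i ∈ Finset.range L, ((dL ^ r) A i - (dL ^ r) (Q1 + shR L Q2) i) ^ 2
        = ∑ i ∈ Finset.range L, ((dL ^ r) d i) ^ 2
          + 2 * ∑ i ∈ Finset.range L, (dL ^ r) d i * ((dL ^ r) A1 i - (dL ^ r) Q1 i)
          + ∑ i ∈ Finset.range L, ((dL ^ r) A1 i - (dL ^ r) Q1 i) ^ 2 := by
      rw [Finset.mul_sum, ← Finset.sum_add_distrib, ← Finset.sum_add_distrib]
      refine Finset.sum_congr rfl (fun i hi => ?_)
      rw [qlo i hi, dlo i hi]; ring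
    have e2 : ∑ i ∈ Finset.range L, ((dL ^ r) A (i + L) - (dL ^ r) (Q1 + shR L Q2) (i + L)) ^ 2
        = ∑ i ∈ Finset.range L, ((dL ^ r) d (i + L)) ^ 2
          + 2 * ∑ i ∈ Finset.range L, (dL ^ r) d (i + L) * ((dL ^ r) A2 i - (dL ^ r) Q2 i)
          + ∑ i ∈ Finset.range L, ((dL ^ r) A2 i - (dL ^ r) Q2 i) ^ 2 := by
      rw [Finset.mul_sum, ← Finset.sum_add_distrib, ← Finset.sum_add_distrib]
      refine Finset.sum_congr rfl (fun i hi => ?_)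
      rw [qhi i, dhi i]; ring
    rw [e1, e2, c1, c2]; ring
  · rw [hsplit]
    congr 1
    · refine Finset.sum_congr rfl (fun i hi => ?_)
      rw [map_add, Pi.add_apply, qlo i hi, dlo i hi]; ring
    · refine Finset.sum_congr rfl (fun i hi => ?_)
      rw [map_add, Pi.add_apply, qhi i, dhi i]; ring

/-- Scale of the potential on a cell of length `2^m`. -/
def am (r m : ℕ) : ℝ := ((2 : ℝ) ^ m) ^ (r - 1) * Real.sqrt ((2 : ℝ) ^ m)

lemma am_nonneg (r m : ℕ) : 0 ≤ am r m := by unfold am; positivity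

lemma am_succ (r m : ℕ) : 7 / 5 * am r m ≤ am r (m + 1) := by
  unfold am
  have h1 : ((2 : ℝ) ^ m) ^ (r - 1) ≤ ((2 : ℝ) ^ (m + 1)) ^ (r - 1) := by
    gcongr <;> norm_num
  have h2 : 7 / 5 * Real.sqrt ((2 : ℝ) ^ m) ≤ Real.sqrt ((2 : ℝ) ^ (m + 1)) := by
    apply Real.le_sqrt_of_sq_le
    rw [mul_pow, Real.sq_sqrt (by positivity), pow_succ (2 : ℝ) m]
    nlinarith [pow_pos (show (0:ℝ) < 2 by norm_num) m]
  calc 7 / 5 * (((2 : ℝ) ^ m) ^ (r - 1) * Real.sqrt ((2 : ℝ) ^ m))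
      = ((2 : ℝ) ^ m) ^ (r - 1) * (7 / 5 * Real.sqrt ((2 : ℝ) ^ m)) := by ring
    _ ≤ _ := mul_le_mul h1 h2 (by positivity) (by positivity)

lemma zt_shift (r : ℕ) {n : ℕ} (σ : ℝ) (ξ : Fin n → ℝ) (α L : ℕ) :
    (fun i => zt r σ ξ α (i + L)) = zt r σ ξ (α + L) := by
  funext i
  simp only [zt]
  congr 2
  omega

/-- The basic constant. -/
def C0 (r : ℕ) : ℝ := 11520 * (r : ℝ) ^ 3

lemma noise_claim (r : ℕ) (hr : 1 ≤ r) (m : ℕ) : ∀ τ : ℝ, 0 < τ → ∃ G : (ℕ → ℝ) → ℝ,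
    (∀ z, ∃ Q ∈ supSub r (2 ^ m), (∀ x, |Q x| ≤ 21 * τ * am r m) ∧
      ∑ i ∈ Finset.range (2 ^ m), ((dL ^ r) (pA r (2 ^ m) z) i - (dL ^ r) Q i) ^ 2 ≤ G z) ∧
    ∀ (n : ℕ) (σ : ℝ), 0 < σ → ∀ α, BddE n σ (fun ξ => G (zt r σ ξ α)) (3 * C0 r / τ ^ 4) := by
  induction m with
  | zero =>
    intro τ hτ
    refine ⟨fun _ => 0, ?_, ?_⟩
    · intro z
      refine ⟨0, Submodule.zero_mem _, ?_, ?_⟩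
      · intro x; simp only [Pi.zero_apply, abs_zero]
        exact mul_nonneg (by positivity) (am_nonneg _ _)
      · have : pA r (2 ^ 0) z = 0 := by
          funext x
          exact pA_mem r (2 ^ 0) z x (by simp; omega)
        rw [this]; simp
    · intro n σ hσ α
      refine ⟨integrable_const _, ?_⟩
      simp only [integral_zero]
      unfold C0; positivity
  | succ m ih =>
    intro τ hτ
    obtain ⟨G, hG, hB⟩ := ih (4 / 3 * τ) (by positivity)
    set L := 2 ^ m with hL
    have h2L : 2 ^ (m + 1) = L + L := by rw [hL, pow_succ]; ring
    refine ⟨fun z => G z + G (fun i => z (i + L)) + (2880 * (r : ℝ) ^ 2 / τ ^ 4) *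
      (Nc r L z + Nc r L (fun i => z (i + L))), ?_, ?_⟩
    · intro z
      rw [h2L]
      obtain ⟨Q1, mQ1, bQ1, sQ1⟩ := hG z
      obtain ⟨Q2, mQ2, bQ2, sQ2⟩ := hG (fun i => z (i + L))
      obtain ⟨d, md, -, hdN, hres, hres'⟩ := split_lemma r L z Q1 Q2 mQ1 mQ2
      have hnn : 0 ≤ (2880 * (r : ℝ) ^ 2 / τ ^ 4) *
          (Nc r L z + Nc r L (fun i => z (i + L))) := by
        have := Nc_nonneg r L z
        have := Nc_nonneg r L (fun i => z (i + L))
        positivity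
      have hb : ∀ x, |(Q1 + shR L Q2) x| ≤ 20 * τ * am r (m + 1) := by
        intro x
        have hs := am_succ r m
        have h3 : 21 * (4 / 3 * τ) * am r m ≤ 20 * τ * am r (m + 1) := by nlinarith
        simp only [Pi.add_apply, shR]
        split_ifs with hx
        · rw [add_zero]; exact (bQ1 x).trans h3
        · rw [supSub_hi mQ1 x (by omega), zero_add]; exact (bQ2 _).trans h3
      have mQ : Q1 + shR L Q2 ∈ supSub r (L + L) :=
        Submodule.add_mem _ (supSub_mono (Nat.le_add_left L L) mQ1) (shR_mem mQ2)
      by_cases hcase : ∑ i ∈ Finset.range (L + L), ((dL ^ r) d i) ^ 2 ≤ τ ^ 2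
      · refine ⟨Q1 + shR L Q2 + d, Submodule.add_mem _ mQ md, ?_, ?_⟩
        · intro x
          have hd : |d x| ≤ τ * am r (m + 1) := by
            by_cases hx : x ≤ L + L
            · have := sup_bound r hr (L + L) τ hτ.le d (supSub_lo md) hcase x hx
              unfold am
              rw [← h2L] at this
              simpa using this
            · rw [supSub_hi md x (by omega), abs_zero]
              exact mul_nonneg hτ.le (am_nonneg _ _)
          calc |(Q1 + shR L Q2 + d) x| ≤ |(Q1 + shR L Q2) x| + |d x| := abs_add_le _ _
            _ ≤ 20 * τ * am r (m + 1) + τ * am r (m + 1) := add_le_add (hb x) hd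
            _ = _ := by ring
        · rw [hres']; linarith
      · refine ⟨Q1 + shR L Q2, mQ, ?_, ?_⟩
        · intro x
          refine (hb x).trans ?_
          nlinarith [am_nonneg r (m + 1), mul_nonneg hτ.le (am_nonneg r (m + 1))]
        · rw [hres]
          set S := ∑ i ∈ Finset.range (L + L), ((dL ^ r) d i) ^ 2 with hS
          have hS0 : τ ^ 2 < S := not_le.1 hcase
          set N1 := Nn r L z
          set N2 := Nn r L (fun i => z (i + L))
          have n1 : 0 ≤ N1 := Nn_nonneg _ _ _
          have n2 : 0 ≤ N2 := Nn_nonneg _ _ _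
          have k1 := Nn_cube r L hr z
          have k2 := Nn_cube r L hr (fun i => z (i + L))
          have hS1 : S * τ ^ 4 ≤ S ^ 3 := by
            have : τ ^ 4 ≤ S ^ 2 := by nlinarith [sq_nonneg τ]
            nlinarith [sq_nonneg τ]
          have hS2 : S ^ 3 ≤ (N1 + N2) ^ 3 :=
            pow_le_pow_left₀ ((sq_nonneg τ).trans hS0.le) hdN 3
          have hS3 : (N1 + N2) ^ 3 ≤ 4 * (N1 ^ 3 + N2 ^ 3) := by
            nlinarith [mul_nonneg (add_nonneg n1 n2) (sq_nonneg (N1 - N2))]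
          have hfin : S ≤ (2880 * (r : ℝ) ^ 2 / τ ^ 4) *
              (Nc r L z + Nc r L (fun i => z (i + L))) := by
            rw [div_mul_eq_mul_div, le_div_iff₀ (by positivity)]
            linarith
          linarith
    · intro n σ hσ α
      have b1 := hB n σ hσ α
      have b2 := hB n σ hσ (α + L)
      have b3 := ((Nc_bdd r n σ hσ L α).add (Nc_bdd r n σ hσ L (α + L))).mul
        (c := 2880 * (r : ℝ) ^ 2 / τ ^ 4) (by positivity)
      have := (b1.add b2).add b3
      simp only [zt_shift]
      refine ⟨this.1, this.2.trans ?_⟩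
      have hC : 0 ≤ C0 r / τ ^ 4 := by unfold C0; positivity
      have e1 : 3 * C0 r / (4 / 3 * τ) ^ 4 = 243 / 256 * (C0 r / τ ^ 4) := by
        field_simp; ring
      have e2 : 2880 * (r : ℝ) ^ 2 / τ ^ 4 * (2 * r + 2 * r) = C0 r / τ ^ 4 := by
        unfold C0; field_simp; ring
      rw [e1, e2, mul_div_assoc]
      linarith

/-- Constant of the cell lemma. -/
def C2 (r : ℕ) : ℝ := 4 * r + 3 * C0 r

lemma C2_nonneg (r : ℕ) : 0 ≤ C2 r := by unfold C2 C0; positivity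

lemma cell_lemma (r : ℕ) (hr : 1 ≤ r) (m : ℕ) : ∃ G : (ℕ → ℝ) → ℝ,
    (∀ z, ∃ Q ∈ supSub r (2 ^ m), (∀ x, |Q x| ≤ 21 * am r m) ∧
      ∑ i ∈ Finset.range (2 ^ m), (z i - (dL ^ r) Q i) ^ 2 ≤ G z) ∧
    ∀ (n : ℕ) (σ : ℝ), 0 < σ → ∀ α, BddE n σ (fun ξ => G (zt r σ ξ α)) (C2 r) := by
  obtain ⟨G, hG, hB⟩ := noise_claim r hr m 1 one_pos
  refine ⟨fun z => 2 * Nc r (2 ^ m) z + G z, ?_, ?_⟩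
  · intro z
    obtain ⟨Q, mQ, bQ, sQ⟩ := hG z
    refine ⟨Q, mQ, by simpa using bQ, ?_⟩
    have o := pA_orth r (2 ^ m) z (pA r (2 ^ m) z - Q) (Submodule.sub_mem _ (pA_mem _ _ _) mQ)
    have e : ∑ i ∈ Finset.range (2 ^ m), (z i - (dL ^ r) Q i) ^ 2
        = ∑ i ∈ Finset.range (2 ^ m), (z i - (dL ^ r) (pA r (2 ^ m) z) i) ^ 2
          + 2 * ∑ i ∈ Finset.range (2 ^ m), (z i - (dL ^ r) (pA r (2 ^ m) z) i)
            * (dL ^ r) (pA r (2 ^ m) z - Q) i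
          + ∑ i ∈ Finset.range (2 ^ m),
            ((dL ^ r) (pA r (2 ^ m) z) i - (dL ^ r) Q i) ^ 2 := by
      rw [Finset.mul_sum, ← Finset.sum_add_distrib, ← Finset.sum_add_distrib]
      refine Finset.sum_congr rfl (fun i hi => ?_)
      rw [map_sub, Pi.sub_apply]; ring
    rw [e, o]
    have := pA_res r (2 ^ m) z
    have := Nn_le r (2 ^ m) z
    linarith
  · intro n σ hσ α
    have := ((Nc_bdd r n σ hσ (2 ^ m) α).mul (c := 2) (by norm_num)).add (hB n σ hσ α)
    refine ⟨this.1, this.2.trans ?_⟩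
    unfold C2
    simp only [one_pow, div_one]
    linarith

/-- Forward averaging operator. -/
def avg (w : ℕ) : Module.End ℝ (ℕ → ℝ) where
  toFun f := fun y => 1 / (w : ℝ) * ∑ j ∈ Finset.range w, f (y + j)
  map_add' f g := by
    funext y; simp only [Pi.add_apply, Finset.sum_add_distrib]; ring
  map_smul' c f := by
    funext y
    simp only [Pi.smul_apply, smul_eq_mul, ← Finset.mul_sum, RingHom.id_apply]; ring

lemma avg_apply (w : ℕ) (f : ℕ → ℝ) (y : ℕ) :
    avg w f y = 1 / (w : ℝ) * ∑ j ∈ Finset.range w, f (y + j) := rfl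

lemma avg_pow_le (w : ℕ) (hw : 1 ≤ w) (f : ℕ → ℝ) (c : ℝ) (r : ℕ) : ∀ y : ℕ,
    (∀ x, y ≤ x → x ≤ y + r * (w - 1) → f x ≤ c) → ((avg w) ^ r) f y ≤ c := by
  induction r with
  | zero => intro y h; simpa using h y le_rfl (by simp)
  | succ r ih =>
    intro y h
    rw [pow_succ', Module.End.mul_apply, avg_apply]
    have hw' : (0 : ℝ) < w := by exact_mod_cast hw
    have : ∑ j ∈ Finset.range w, ((avg w) ^ r) f (y + j) ≤ ∑ j ∈ Finset.range w, c := by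
      apply Finset.sum_le_sum
      intro j hj
      apply ih
      intro x h1 h2
      apply h x (by omega)
      have := Finset.mem_range.1 hj
      rw [add_mul, one_mul]; omega
    rw [Finset.sum_const, Finset.card_range, nsmul_eq_mul] at this
    rw [one_div, inv_mul_le_iff₀ hw']
    exact this

lemma avg_pow_ge (w : ℕ) (hw : 1 ≤ w) (f : ℕ → ℝ) (c : ℝ) (r : ℕ) (y : ℕ)
    (h : ∀ x, y ≤ x → x ≤ y + r * (w - 1) → c ≤ f x) : c ≤ ((avg w) ^ r) f y := by
  have := avg_pow_le w hw (-f) (-c) r y (fun x h1 h2 => by simpa using h x h1 h2)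
  rw [map_neg, Pi.neg_apply] at this
  linarith

lemma dL_avg (w : ℕ) (f : ℕ → ℝ) (y : ℕ) :
    (dL * avg w) f y = 1 / (w : ℝ) * (f (y + w) - f y) := by
  rw [Module.End.mul_apply, dL_apply, avg_apply, avg_apply, ← mul_sub, ← Finset.sum_sub_distrib]
  congr 1
  have := Finset.sum_range_sub (fun j => f (y + j)) w
  simp only [add_zero] at this
  rw [← this]
  apply Finset.sum_congr rfl
  intro j _
  congr 2
  ring

lemma dL_avg_comm (w : ℕ) : Commute dL (avg w) := by
  refine LinearMap.ext (fun f => funext (fun y => ?_))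
  rw [dL_avg, Module.End.mul_apply, avg_apply]
  congr 1
  have := Finset.sum_range_sub (fun j => f (y + j)) w
  simp only [add_zero] at this
  rw [← this]
  apply Finset.sum_congr rfl
  intro j _
  rw [dL_apply]
  rfl

lemma dL_avg_pow (w r : ℕ) (f : ℕ → ℝ) (B : ℝ) (hB : ∀ y, |f y| ≤ B) (y : ℕ) :
    |(dL ^ r) (((avg w) ^ r) f) y| ≤ (2 / (w : ℝ)) ^ r * B := by
  rw [← Module.End.mul_apply, ← (dL_avg_comm w).mul_pow]
  induction r generalizing y with
  | zero => simpa using hB y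
  | succ r ih =>
    rw [pow_succ', Module.End.mul_apply, dL_avg, abs_mul, abs_of_nonneg (by positivity)]
    have h1 := ih (y + w)
    have h2 := ih y
    calc 1 / (w : ℝ) * |((dL * avg w) ^ r) f (y + w) - ((dL * avg w) ^ r) f y|
        ≤ 1 / (w : ℝ) * ((2 / (w : ℝ)) ^ r * B + (2 / (w : ℝ)) ^ r * B) := by
          apply mul_le_mul_of_nonneg_left _ (by positivity)
          exact (abs_sub _ _).trans (add_le_add h1 h2)
      _ = _ := by rw [pow_succ]; ring

lemma bump_lemma (r : ℕ) (hr : 1 ≤ r) (m a : ℕ) : ∃ φ : ℕ → ℝ, (∀ y, 0 ≤ φ y) ∧ (∀ y, φ y ≤ 1) ∧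
    (∀ y, a * 2 ^ m ≤ y → y < (a + 1) * 2 ^ m → φ y = 1) ∧
    (∀ y, φ y ≠ 0 → a * 2 ^ m ≤ y + 2 ^ m ∧ y < (a + 2) * 2 ^ m) ∧
    ∀ y, |(dL ^ r) φ y| ≤ (2 * (r : ℝ)) ^ r / ((2 : ℝ) ^ m) ^ r := by
  set L := 2 ^ m with hL
  set w := L / r + 1 with hw
  have hw1 : 1 ≤ w := Nat.le_add_left 1 _
  have hwL : r * (w - 1) ≤ L := by rw [hw]; simp; exact Nat.mul_div_le L r
  set f : ℕ → ℝ := fun y => if a * L ≤ y ∧ y < (a + 1) * L + r * (w - 1) then 1 else 0 with hf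
  have f0 : ∀ y, 0 ≤ f y := by intro y; simp only [hf]; split_ifs <;> norm_num
  have f1 : ∀ y, f y ≤ 1 := by intro y; simp only [hf]; split_ifs <;> norm_num
  have p0 : ∀ y, 0 ≤ ((avg w) ^ r) f y := fun y =>
    avg_pow_ge w hw1 f 0 r y (fun x _ _ => f0 x)
  have p1 : ∀ y, ((avg w) ^ r) f y ≤ 1 := fun y =>
    avg_pow_le w hw1 f 1 r y (fun x _ _ => f1 x)
  refine ⟨((avg w) ^ r) f, p0, p1, ?_, ?_, ?_⟩
  · intro y h1 h2
    refine le_antisymm (p1 y) (avg_pow_ge w hw1 f 1 r y (fun x h3 h4 => ?_))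
    simp only [hf]
    rw [if_pos ⟨by omega, by omega⟩]
  · intro y hy
    by_contra hcon
    apply hy
    refine le_antisymm (avg_pow_le w hw1 f 0 r y (fun x h3 h4 => ?_)) (p0 y)
    simp only [hf]
    rw [if_neg]
    rintro ⟨h5, h6⟩
    apply hcon
    constructor
    · omega
    · have : (a + 2) * L = (a + 1) * L + L := by ring
      omega
  · intro y
    refine (dL_avg_pow w r f 1 (fun y => abs_le.2 ⟨by linarith [f0 y], f1 y⟩) y).trans ?_
    rw [mul_one, ← div_pow]
    apply pow_le_pow_left₀ (by positivity)
    have h3 : L < r * w := by rw [hw]; exact Nat.lt_mul_div_succ L (by omega)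
    have h4 : (2 : ℝ) ^ m < r * w := by exact_mod_cast h3
    have hw0 : (0 : ℝ) < w := by rw [hw]; positivity
    rw [div_le_div_iff₀ hw0 (by positivity)]
    linarith

lemma theta_lemma (θ : ℝ) (h0 : 0 ≤ θ) (h1 : θ < 1) (N : ℕ) : ∀ (U : ℕ → ℝ) (D : ℝ), 0 ≤ D →
    (∀ m, 0 ≤ U m) → (∀ m, U m ≤ D * θ ^ m) →
    (∑ m ∈ Finset.range N, U m) ^ 2 ≤ 2 * D / (1 - θ) * ∑ m ∈ Finset.range N, U m * θ ^ m := by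
  induction N with
  | zero => intro U D _ _ _; simp
  | succ N ih =>
    intro U D hD hU hUD
    have h2 := ih (fun m => U (m + 1)) (D * θ) (mul_nonneg hD h0) (fun m => hU _)
      (fun m => by have := hUD (m + 1); rw [pow_succ] at this; linarith)
    rw [Finset.sum_range_succ', Finset.sum_range_succ']
    set S := ∑ m ∈ Finset.range N, U (m + 1) with hS
    have hpos : 0 < 1 - θ := by linarith
    have hgeo : S + U 0 ≤ D / (1 - θ) := by
      have : S + U 0 = ∑ m ∈ Finset.range (N + 1), U m := by rw [Finset.sum_range_succ']
      rw [this]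
      calc ∑ m ∈ Finset.range (N + 1), U m ≤ ∑ m ∈ Finset.range (N + 1), D * θ ^ m :=
            Finset.sum_le_sum (fun m _ => hUD m)
        _ = D * ∑ m ∈ Finset.range (N + 1), θ ^ m := by rw [Finset.mul_sum]
        _ ≤ D * (1 - θ)⁻¹ := by
            apply mul_le_mul_of_nonneg_left _ hD
            rw [← tsum_geometric_of_lt_one h0 h1]
            exact (summable_geometric_of_lt_one h0 h1).sum_le_tsum _ (fun i _ => pow_nonneg h0 i)
        _ = _ := by rw [div_eq_mul_inv]
    have hS0 : 0 ≤ S := Finset.sum_nonneg (fun m _ => hU _)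
    have e : 2 * (D * θ) / (1 - θ) * ∑ m ∈ Finset.range N, U (m + 1) * θ ^ m
        = 2 * D / (1 - θ) * ∑ m ∈ Finset.range N, U (m + 1) * θ ^ (m + 1) := by
      rw [Finset.mul_sum, Finset.mul_sum]
      refine Finset.sum_congr rfl (fun m _ => ?_)
      rw [pow_succ]; ring
    rw [e] at h2
    rw [mul_add, pow_zero, mul_one]
    have hU0 := hU 0
    have : U 0 * (U 0 + 2 * S) ≤ U 0 * (2 * (D / (1 - θ))) :=
      mul_le_mul_of_nonneg_left (by linarith) hU0
    have e2 : 2 * D / (1 - θ) * U 0 = U 0 * (2 * (D / (1 - θ))) := by ring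
    rw [e2]
    nlinarith

/-- The sign profile. -/
lemma chi_lemma (r : ℕ) (n : ℕ) (ρ : ℝ) (hρ : 0 < ρ) (hr : 1 ≤ r) (X : Finset ℕ) (s : ℕ → ℝ)
    (hX : ∀ x ∈ X, r ≤ x ∧ x < n ∧ ρ ≤ x ∧ ρ + x ≤ n ∧ (s x = 1 ∨ s x = -1))
    (hsep : ∀ x ∈ X, ∀ y ∈ X, x < y → s x ≠ s y → ρ + x ≤ y) :
    ∃ (χ : ℕ → ℝ) (w : ℕ), 1 ≤ w ∧ ρ ≤ 4 * r * w ∧ (∀ y, |χ y| ≤ 1) ∧ (∀ x ∈ X, χ x = s x) ∧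
      (∀ y, 0 < χ y → ∃ x ∈ X, s x = 1 ∧ |(x : ℝ) - y| ≤ ρ / 4) ∧
      (∀ y, χ y < 0 → ∃ x ∈ X, s x = -1 ∧ |(x : ℝ) - y| ≤ ρ / 4) ∧
      (∀ y, y < r → χ y = 0) ∧ (∀ y, n ≤ y → χ y = 0) ∧
      (∀ y, |(dL ^ r) χ y| ≤ (2 / (w : ℝ)) ^ r) ∧
      ∃ S : Finset ℕ, (S.card : ℝ) ≤ X.card * (3 * r * w) ∧ ∀ y, y ∉ S → (dL ^ r) χ y = 0 := by
  classical
  set w := ⌊ρ / (4 * r)⌋₊ + 1 with hw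
  have hr0 : (0 : ℝ) < r := by exact_mod_cast hr
  have hw1 : 1 ≤ w := by omega
  set d := r * (w - 1) with hd
  have hdρ : (d : ℝ) ≤ ρ / 4 := by
    rw [hd, hw]
    simp only [Nat.add_sub_cancel, Nat.cast_mul]
    have := Nat.floor_le (show 0 ≤ ρ / (4 * r) by positivity)
    rw [le_div_iff₀ (by positivity)] at this
    linarith
  have hwρ : ρ ≤ 4 * r * w := by
    have := Nat.lt_floor_add_one (ρ / (4 * (r : ℝ)))
    rw [div_lt_iff₀ (by positivity)] at this
    rw [hw]; push_cast; linarith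
  set g : ℕ → ℝ := fun y => if ∃ x ∈ X, s x = 1 ∧ x ≤ y ∧ y ≤ x + d then 1 else
    if ∃ x ∈ X, s x = -1 ∧ x ≤ y ∧ y ≤ x + d then -1 else 0 with hg
  have g1 : ∀ y, g y ≤ 1 := by intro y; simp only [hg]; split_ifs <;> norm_num
  have g2 : ∀ y, -1 ≤ g y := by intro y; simp only [hg]; split_ifs <;> norm_num
  set χ := ((avg w) ^ r) g with hχ
  have near : ∀ x y z : ℕ, y ≤ z → z ≤ y + d → x ≤ z → z ≤ x + d → |(x : ℝ) - y| ≤ ρ / 4 := by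
    intro x y z a1 a2 a3 a4
    refine le_trans ?_ hdρ
    have b1 : (x : ℝ) ≤ y + d := by exact_mod_cast (by omega : x ≤ y + d)
    have b2 : (y : ℝ) ≤ x + d := by exact_mod_cast (by omega : y ≤ x + d)
    rw [abs_le]; constructor <;> linarith
  have samesign : ∀ x ∈ X, ∀ y ∈ X, |(x : ℝ) - y| ≤ ρ / 4 → s x = s y := by
    intro x hx y hy hxy
    by_contra hne
    rw [abs_le] at hxy
    rcases lt_trichotomy x y with h | h | h
    · have := hsep x hx y hy h hne; linarith
    · exact hne (by rw [h])
    · have := hsep y hy x hx h (Ne.symm hne); linarith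
  have hpos : ∀ y, 0 < χ y → ∃ x ∈ X, s x = 1 ∧ y ≤ x + d ∧ x ≤ y + d ∧ |(x : ℝ) - y| ≤ ρ / 4 := by
    intro y hy
    by_contra hcon
    refine absurd (avg_pow_le w hw1 g 0 r y (fun z h1 h2 => ?_)) (not_le.2 hy)
    simp only [hg]
    rw [if_neg]
    · split_ifs <;> norm_num
    · rintro ⟨x, hx, h3, h4, h5⟩
      exact hcon ⟨x, hx, h3, by omega, by omega, near x y z h1 h2 h4 h5⟩
  have hneg : ∀ y, χ y < 0 → ∃ x ∈ X, s x = -1 ∧ y ≤ x + d ∧ x ≤ y + d ∧ |(x : ℝ) - y| ≤ ρ / 4 := by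
    intro y hy
    by_contra hcon
    refine absurd (avg_pow_ge w hw1 g 0 r y (fun z h1 h2 => ?_)) (not_le.2 hy)
    simp only [hg]
    split_ifs with c1 c2
    · norm_num
    · obtain ⟨x, hx, h3, h4, h5⟩ := c2
      exact (hcon ⟨x, hx, h3, by omega, by omega, near x y z h1 h2 h4 h5⟩).elim
    · exact le_rfl
  have hne : ∀ y, χ y ≠ 0 → ∃ x ∈ X, y ≤ x + d ∧ x ≤ y + d ∧ |(x : ℝ) - y| ≤ ρ / 4 := by
    intro y hy
    rcases lt_or_gt_of_ne hy with h | h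
    · obtain ⟨x, hx, _, h⟩ := hneg y h; exact ⟨x, hx, h⟩
    · obtain ⟨x, hx, _, h⟩ := hpos y h; exact ⟨x, hx, h⟩
  have hw4 : w ≠ 1 → 4 * (r : ℝ) ≤ ρ := by
    intro h
    by_contra hlt
    apply h
    rw [hw, Nat.floor_eq_zero.2]
    rw [div_lt_one (by positivity)]; linarith
  have hin : ∀ y, χ y ≠ 0 → r ≤ y ∧ y < n := by
    intro y hy
    obtain ⟨x, hx, h1, h2, h3⟩ := hne y hy
    obtain ⟨k1, k2, k3, k4, -⟩ := hX x hx
    by_cases hw' : w = 1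
    · have : d = 0 := by rw [hd, hw']; simp
      omega
    · have h4 := hw4 hw'
      rw [abs_le] at h3
      constructor
      · have : (r : ℝ) ≤ y := by linarith
        exact_mod_cast this
      · have : (y : ℝ) < n := by linarith
        exact_mod_cast this
  refine ⟨χ, w, hw1, hwρ, ?_, ?_, ?_, ?_, ?_, ?_, ?_, ?_⟩
  · intro y
    rw [abs_le]
    exact ⟨avg_pow_ge w hw1 g (-1) r y (fun z _ _ => g2 z), avg_pow_le w hw1 g 1 r y (fun z _ _ => g1 z)⟩
  · intro x hx
    have key : ∀ z, x ≤ z → z ≤ x + r * (w - 1) → g z = s x := by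
      intro z h1 h2
      simp only [hg]
      split_ifs with c1 c2
      · obtain ⟨x', hx', h3, h4, h5⟩ := c1
        rw [← h3]; exact samesign x' hx' x hx (near x' x z h1 h2 h4 h5)
      · obtain ⟨x', hx', h3, h4, h5⟩ := c2
        rw [← h3]; exact samesign x' hx' x hx (near x' x z h1 h2 h4 h5)
      · rcases (hX x hx).2.2.2.2 with h | h
        · exact (c1 ⟨x, hx, h, h1, h2⟩).elim
        · exact (c2 ⟨x, hx, h, h1, h2⟩).elim
    exact le_antisymm (avg_pow_le w hw1 g _ r x (fun z h1 h2 => (key z h1 h2).le))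
      (avg_pow_ge w hw1 g _ r x (fun z h1 h2 => (key z h1 h2).ge))
  · intro y hy; obtain ⟨x, hx, h1, -, -, h2⟩ := hpos y hy; exact ⟨x, hx, h1, h2⟩
  · intro y hy; obtain ⟨x, hx, h1, -, -, h2⟩ := hneg y hy; exact ⟨x, hx, h1, h2⟩
  · intro y hy; by_contra h; have := hin y h; omega
  · intro y hy; by_contra h; have := hin y h; omega
  · intro y
    simpa using dL_avg_pow w r g 1 (fun y => abs_le.2 ⟨g2 y, g1 y⟩) y
  · refine ⟨X.biUnion (fun x => Finset.Icc (x - (d + r)) (x + d)), ?_, ?_⟩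
    · have : (X.biUnion (fun x => Finset.Icc (x - (d + r)) (x + d))).card ≤ X.card * (3 * r * w) := by
        apply Finset.card_biUnion_le_card_mul
        intro x hx
        rw [Nat.card_Icc]
        have e : d + r = r * w := by
          rw [hd, hw]; simp; ring
        have : 1 ≤ r * w := Nat.one_le_iff_ne_zero.2 (by positivity)
        have : 3 * r * w = 3 * (r * w) := by ring
        omega
      exact_mod_cast this
    · intro y hy
      apply dLp_zero_of
      intro x h1 h2
      by_contra hx
      obtain ⟨x', hx', k1, k2, -⟩ := hne x hx
      apply hy
      rw [Finset.mem_biUnion]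
      exact ⟨x', hx', Finset.mem_Icc.2 ⟨by omega, by omega⟩⟩

/-- The tripled dyadic cell avoids `F` and the cell is short. -/
def kept (F : Finset ℕ) (ρ : ℝ) (m a : ℕ) : Prop :=
  6 * (2 : ℝ) ^ m ≤ ρ ∧ ∀ f ∈ F, ¬(a * 2 ^ m ≤ f + 2 ^ m ∧ f < (a + 2) * 2 ^ m)

lemma kept_down (F : Finset ℕ) (ρ : ℝ) (m a : ℕ) (h : kept F ρ (m + 1) (a / 2)) :
    kept F ρ m a := by
  refine ⟨?_, ?_⟩
  · have := h.1
    rw [pow_succ] at this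
    have : (0 : ℝ) < 2 ^ m := by positivity
    linarith
  · rintro f hf ⟨h1, h2⟩
    apply h.2 f hf
    rw [pow_succ]
    generalize 2 ^ m = L at *
    obtain ⟨b, hb | hb⟩ : ∃ b, a = 2 * b ∨ a = 2 * b + 1 := ⟨a / 2, by omega⟩
    · have : a / 2 = b := by omega
      rw [this]; subst hb
      constructor <;> nlinarith
    · have : a / 2 = b := by omega
      rw [this]; subst hb
      constructor <;> nlinarith

lemma kept_le (F : Finset ℕ) (ρ : ℝ) (i m m' : ℕ) (hm : m ≤ m') (h : kept F ρ m' (i / 2 ^ m')) :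
    kept F ρ m (i / 2 ^ m) := by
  induction m', hm using Nat.le_induction with
  | base => exact h
  | succ k hk ih =>
    apply ih
    apply kept_down
    rwa [Nat.div_div_eq_div_mul, ← pow_succ]

lemma cell_index (m a i : ℕ) (h1 : a * 2 ^ m ≤ i) (h2 : i < (a + 1) * 2 ^ m) : a = i / 2 ^ m := by
  symm
  rw [Nat.div_eq_iff (by positivity)]
  have : (a + 1) * 2 ^ m = a * 2 ^ m + 2 ^ m := by ring
  have : 0 < 2 ^ m := by positivity
  omega

lemma scale_lt (ρ : ℝ) (m : ℕ) (h : 6 * (2 : ℝ) ^ m ≤ ρ) :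
    m < ⌊Real.log (1 + ρ) / Real.log 2⌋₊ := by
  rw [Nat.lt_iff_add_one_le, Nat.le_floor_iff']
  · rw [le_div_iff₀ (Real.log_pos (by norm_num)), ← Real.log_pow]
    apply Real.log_le_log (by positivity)
    rw [pow_succ]
    have : (0 : ℝ) < 2 ^ m := by positivity
    linarith
  · omega

lemma geo_arith (r M f x : ℕ) (q l t t1 t2 d : ℝ) (hq : 0 ≤ q) (hl : 0 ≤ l) (hM : (M : ℝ) ≤ 2 * l)
    (hM0 : (0 : ℝ) ≤ M) (hF : (f : ℝ) ≤ x + (r + 1)) (ht : t = t1 + t2)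
    (ht1 : t1 ≤ M * (f * 6)) (ht2 : t2 ≤ 12 * q + 1) (hd : d ≤ 6 * q + 3 * f) :
    t + d ≤ (12 * r + 31) * (q + (x + 1) * (1 + l)) := by
  have hX0 : (0 : ℝ) ≤ x := by positivity
  have hr0 : (0 : ℝ) ≤ r := by positivity
  have hF0 : (0 : ℝ) ≤ f := by positivity
  have hF2 : (f : ℝ) ≤ (r + 1) * (x + 1) := by nlinarith
  have s1 : (M : ℝ) * (f * 6) ≤ 12 * (l * ((r + 1) * (x + 1))) := by
    have : (M : ℝ) * f ≤ (2 * l) * ((r + 1) * (x + 1)) :=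
      mul_le_mul hM hF2 hF0 (by positivity)
    linarith
  have s2 : 0 ≤ l * (x + 1) := by positivity
  have s3 : 0 ≤ (r : ℝ) * (x + 1) := by positivity
  have s4 : 0 ≤ (r : ℝ) * q := by positivity
  nlinarith

set_option maxHeartbeats 1000000 in
lemma geo_lemma (r n : ℕ) (ρ : ℝ) (hρ : 0 < ρ) (X : Finset ℕ) :
    ∃ (T : Finset (ℕ × ℕ)) (Dr : Finset ℕ),
      (∀ I ∈ T, 6 * (2 : ℝ) ^ I.1 ≤ ρ) ∧
      (∀ I ∈ T, ∀ y, I.2 * 2 ^ I.1 ≤ y + 2 ^ I.1 → y < (I.2 + 2) * 2 ^ I.1 →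
        r ≤ y ∧ y < n ∧ y ∉ X) ∧
      (∀ i < n, i ∈ Dr ∨ ∃ I ∈ T, I.2 * 2 ^ I.1 ≤ i ∧ i < (I.2 + 1) * 2 ^ I.1) ∧
      (∀ I ∈ T, ∀ J ∈ T, ∀ i, I.2 * 2 ^ I.1 ≤ i → i < (I.2 + 1) * 2 ^ I.1 →
        J.2 * 2 ^ J.1 ≤ i → i < (J.2 + 1) * 2 ^ J.1 → I = J) ∧
      (T.card : ℝ) + Dr.card ≤
        (12 * r + 31) * (n / ρ + (X.card + 1) * (1 + Real.log (1 + ρ))) := by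
  classical
  set F : Finset ℕ := X ∪ (Finset.range r ∪ {n}) with hF
  set M := ⌊Real.log (1 + ρ) / Real.log 2⌋₊ with hM
  set T := ((Finset.range M) ×ˢ (Finset.range n)).filter (fun I => I.2 * 2 ^ I.1 < n ∧
    kept F ρ I.1 I.2 ∧ ¬ kept F ρ (I.1 + 1) (I.2 / 2)) with hT
  set Dr := (Finset.range n).filter (fun i => ¬ kept F ρ 0 i) with hDr
  have mT : ∀ I ∈ T, I.2 * 2 ^ I.1 < n ∧ kept F ρ I.1 I.2 ∧ ¬ kept F ρ (I.1 + 1) (I.2 / 2) :=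
    fun I hI => (Finset.mem_filter.1 hI).2
  have hFcard : F.card ≤ X.card + (r + 1) := by
    refine (Finset.card_union_le _ _).trans (Nat.add_le_add_left ?_ _)
    refine (Finset.card_union_le _ _).trans ?_
    simp
  refine ⟨T, Dr, ?_, ?_, ?_, ?_, ?_⟩
  · exact fun I hI => (mT I hI).2.1.1
  · intro I hI y h1 h2
    obtain ⟨k1, k2, -⟩ := mT I hI
    refine ⟨?_, ?_, ?_⟩
    · by_contra h
      exact k2.2 y (by simp [hF]; omega) ⟨h1, h2⟩
    · by_contra h
      exact k2.2 n (by simp [hF]) ⟨k1.le.trans (Nat.le_add_right _ _), by omega⟩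
    · intro h
      exact k2.2 y (by simp [hF, h]) ⟨h1, h2⟩
  · intro i hi
    by_cases h0 : kept F ρ 0 i
    · right
      have : ∃ m, kept F ρ m (i / 2 ^ m) ∧ ¬ kept F ρ (m + 1) (i / 2 ^ (m + 1)) := by
        by_contra hcon
        push Not at hcon
        have hall : ∀ m, kept F ρ m (i / 2 ^ m) := by
          intro m
          induction m with
          | zero => simpa using h0
          | succ m ih => exact hcon m ih
        exact absurd (scale_lt ρ M (hall M).1) (lt_irrefl _)
      obtain ⟨m, hm1, hm2⟩ := this
      have hle : i / 2 ^ m * 2 ^ m ≤ i := Nat.div_mul_le_self _ _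
      refine ⟨(m, i / 2 ^ m), ?_, hle, ?_⟩
      · rw [hT, Finset.mem_filter, Finset.mem_product]
        refine ⟨⟨Finset.mem_range.2 (scale_lt ρ m hm1.1), Finset.mem_range.2 ?_⟩, ?_, hm1, ?_⟩
        · exact lt_of_le_of_lt (Nat.div_le_self _ _) hi
        · exact lt_of_le_of_lt hle hi
        · rwa [Nat.div_div_eq_div_mul, ← pow_succ]
      · have := Nat.lt_mul_div_succ i (show 0 < 2 ^ m by positivity)
        rwa [mul_comm] at this
    · left
      rw [hDr, Finset.mem_filter]
      exact ⟨Finset.mem_range.2 hi, h0⟩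
  · rintro ⟨m, a⟩ hI ⟨m', a'⟩ hJ i h1 h2 h3 h4
    have e1 := cell_index _ _ _ h1 h2
    have e2 := cell_index _ _ _ h3 h4
    have k1 := mT _ hI
    have k2 := mT _ hJ
    simp only at e1 e2 k1 k2
    subst e1 e2
    rw [Nat.div_div_eq_div_mul, ← pow_succ] at k1 k2
    rcases lt_trichotomy m m' with h | h | h
    · exact (k1.2.2 (kept_le F ρ i (m + 1) m' h k2.2.1)).elim
    · rw [h]
    · exact (k2.2.2 (kept_le F ρ i (m' + 1) m h k1.2.1)).elim
  · have hT1 : (T.filter (fun I => 6 * (2 : ℝ) ^ (I.1 + 1) ≤ ρ)).card ≤ M * (F.card * 6) := by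
      have hsub : T.filter (fun I => 6 * (2 : ℝ) ^ (I.1 + 1) ≤ ρ) ⊆
          (Finset.range M).biUnion (fun m => F.biUnion (fun f =>
            (Finset.Icc (2 * (f / 2 ^ (m + 1)) - 2) (2 * (f / 2 ^ (m + 1)) + 3)).image
              (fun a => (m, a)))) := by
        rintro ⟨m, a⟩ hI
        rw [Finset.mem_filter] at hI
        obtain ⟨hI, hI2⟩ := hI
        have hk := mT _ hI
        have hmM := (Finset.mem_product.1 (Finset.mem_filter.1 hI).1).1
        simp only at hk hI2 hmM
        have : ∃ f ∈ F, a / 2 * 2 ^ (m + 1) ≤ f + 2 ^ (m + 1) ∧ f < (a / 2 + 2) * 2 ^ (m + 1) := by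
          by_contra hcon
          push Not at hcon
          apply hk.2.2
          refine ⟨hI2, fun f hf hh => absurd (hcon f hf hh.1) (not_le.2 hh.2)⟩
        obtain ⟨f, hf, h1, h2⟩ := this
        rw [Finset.mem_biUnion]
        refine ⟨m, hmM, ?_⟩
        rw [Finset.mem_biUnion]
        refine ⟨f, hf, ?_⟩
        rw [Finset.mem_image]
        refine ⟨a, ?_, rfl⟩
        have hL : 0 < 2 ^ (m + 1) := by positivity
        have q1 : f / 2 ^ (m + 1) < a / 2 + 2 := (Nat.div_lt_iff_lt_mul hL).2 h2
        have q2 : a / 2 ≤ (f + 2 ^ (m + 1)) / 2 ^ (m + 1) := (Nat.le_div_iff_mul_le hL).2 h1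
        rw [Nat.add_div_right _ hL] at q2
        rw [Finset.mem_Icc]
        omega
      refine (Finset.card_le_card hsub).trans ?_
      have := Finset.card_biUnion_le_card_mul (Finset.range M) (fun m => F.biUnion (fun f =>
            (Finset.Icc (2 * (f / 2 ^ (m + 1)) - 2) (2 * (f / 2 ^ (m + 1)) + 3)).image
              (fun a => (m, a)))) (F.card * 6) (by
        intro m _
        apply Finset.card_biUnion_le_card_mul
        intro f _
        refine Finset.card_image_le.trans ?_
        rw [Nat.card_Icc]; omega)
      simpa using this
    have hT2 : ((T.filter (fun I => ¬ 6 * (2 : ℝ) ^ (I.1 + 1) ≤ ρ)).card : ℝ) ≤ 12 * (n / ρ) + 1 := by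
      rcases (T.filter (fun I => ¬ 6 * (2 : ℝ) ^ (I.1 + 1) ≤ ρ)).eq_empty_or_nonempty with he | ⟨I0, hI0⟩
      · rw [he]; simp; positivity
      · rw [Finset.mem_filter] at hI0
        have key : ∀ I ∈ T.filter (fun I => ¬ 6 * (2 : ℝ) ^ (I.1 + 1) ≤ ρ), I.1 = I0.1 := by
          have aux : ∀ I J : ℕ × ℕ, 6 * (2 : ℝ) ^ I.1 ≤ ρ → ¬ 6 * (2 : ℝ) ^ (J.1 + 1) ≤ ρ →
              I.1 ≤ J.1 := by
            intro I J h1 h2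
            by_contra hlt
            apply h2
            have : (2 : ℝ) ^ (J.1 + 1) ≤ 2 ^ I.1 := pow_le_pow_right₀ (by norm_num) (by omega)
            linarith
          intro I hI
          rw [Finset.mem_filter] at hI
          exact le_antisymm (aux I I0 (mT I hI.1).2.1.1 hI0.2) (aux I0 I (mT I0 hI0.1).2.1.1 hI.2)
        have hsub : T.filter (fun I => ¬ 6 * (2 : ℝ) ^ (I.1 + 1) ≤ ρ) ⊆
            (Finset.range (n / 2 ^ I0.1 + 1)).image (fun a => (I0.1, a)) := by
          intro I hI
          have h1 := key I hI
          have h2 := (mT I (Finset.mem_filter.1 hI).1).1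
          rw [Finset.mem_image]
          refine ⟨I.2, ?_, by rw [← h1]⟩
          rw [Finset.mem_range, Nat.lt_succ_iff, Nat.le_div_iff_mul_le (by positivity), ← h1]
          exact h2.le
        have hc : (T.filter (fun I => ¬ 6 * (2 : ℝ) ^ (I.1 + 1) ≤ ρ)).card ≤ n / 2 ^ I0.1 + 1 := by
          refine (Finset.card_le_card hsub).trans (Finset.card_image_le.trans ?_)
          simp
        have hc' : ((n / 2 ^ I0.1 : ℕ) : ℝ) ≤ n / 2 ^ I0.1 := by
          have := @Nat.cast_div_le ℝ _ _ _ n (2 ^ I0.1)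
          push_cast at this; exact this
        have hc2 : (n : ℝ) / 2 ^ I0.1 ≤ 12 * (n / ρ) := by
          have h3 := hI0.2
          rw [not_le, pow_succ] at h3
          rw [← mul_div_assoc, div_le_div_iff₀ (by positivity) hρ]
          nlinarith [Nat.cast_nonneg (α := ℝ) n]
        have : ((T.filter (fun I => ¬ 6 * (2 : ℝ) ^ (I.1 + 1) ≤ ρ)).card : ℝ) ≤ ((n / 2 ^ I0.1 : ℕ) : ℝ) + 1 := by
          exact_mod_cast hc
        linarith
    have hD : (Dr.card : ℝ) ≤ 6 * (n / ρ) + 3 * F.card := by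
      by_cases h6 : 6 ≤ ρ
      · have hsub : Dr ⊆ F.biUnion (fun f => Finset.Icc (f - 1) (f + 1)) := by
          intro i hi
          have hk := (Finset.mem_filter.1 hi).2
          have : ∃ f ∈ F, i * 2 ^ 0 ≤ f + 2 ^ 0 ∧ f < (i + 2) * 2 ^ 0 := by
            by_contra hcon
            push Not at hcon
            apply hk
            refine ⟨by simpa using h6, fun f hf hh => absurd (hcon f hf hh.1) (not_le.2 hh.2)⟩
          obtain ⟨f, hf, h1, h2⟩ := this
          rw [Finset.mem_biUnion]
          refine ⟨f, hf, ?_⟩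
          rw [Finset.mem_Icc]
          simp at h1 h2
          omega
        have hc : Dr.card ≤ F.card * 3 := by
          refine (Finset.card_le_card hsub).trans ?_
          apply Finset.card_biUnion_le_card_mul
          intro f _
          rw [Nat.card_Icc]; omega
        have : (Dr.card : ℝ) ≤ F.card * 3 := by exact_mod_cast hc
        have : 0 ≤ (n : ℝ) / ρ := by positivity
        linarith
      · have hc : Dr.card ≤ n := by
          refine (Finset.card_filter_le _ _).trans ?_
          simp
        have hc' : (Dr.card : ℝ) ≤ n := by exact_mod_cast hc
        have : (n : ℝ) ≤ 6 * (n / ρ) := by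
          rw [← mul_div_assoc, le_div_iff₀ hρ]
          nlinarith [Nat.cast_nonneg (α := ℝ) n]
        have : (0 : ℝ) ≤ F.card := by positivity
        linarith
    have hn0 : 0 ≤ (n : ℝ) / ρ := by positivity
    have hlog : 0 ≤ Real.log (1 + ρ) := Real.log_nonneg (by linarith)
    have hMl : (M : ℝ) ≤ 2 * Real.log (1 + ρ) := by
      have h2 : (1 : ℝ) / 2 < Real.log 2 := by linarith [Real.log_two_gt_d9]
      have := Nat.floor_le (show 0 ≤ Real.log (1 + ρ) / Real.log 2 by
        apply div_nonneg hlog; linarith)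
      refine this.trans ?_
      rw [div_le_iff₀ (by linarith)]
      nlinarith
    have hTc : (T.card : ℝ) = ((T.filter (fun I => 6 * (2 : ℝ) ^ (I.1 + 1) ≤ ρ)).card : ℝ)
        + ((T.filter (fun I => ¬ 6 * (2 : ℝ) ^ (I.1 + 1) ≤ ρ)).card : ℝ) := by
      exact_mod_cast (Finset.card_filter_add_card_filter_not (s := T) (fun I => 6 * (2 : ℝ) ^ (I.1 + 1) ≤ ρ)).symm
    have hT1' : ((T.filter (fun I => 6 * (2 : ℝ) ^ (I.1 + 1) ≤ ρ)).card : ℝ) ≤ M * (F.card * 6) := by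
      exact_mod_cast hT1
    have hF' : (F.card : ℝ) ≤ X.card + (r + 1) := by exact_mod_cast hFcard
    exact geo_arith r M F.card X.card _ _ _ _ _ _ hn0 hlog hMl (by positivity) hF' hTc hT1' hT2 hD

/-- `y` is within `c` to the left of the tripled cell `I`. -/
def act (c y : ℕ) (I : ℕ × ℕ) : Prop :=
  I.2 * 2 ^ I.1 ≤ y + c + 2 ^ I.1 ∧ y < (I.2 + 2) * 2 ^ I.1

instance (c y : ℕ) (I : ℕ × ℕ) : Decidable (act c y I) := by unfold act; infer_instance

lemma scale_count (T : Finset (ℕ × ℕ)) (c y m : ℕ) :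
    ((T.filter (fun I => I.1 = m)).filter (fun I => act c y I)).card ≤ c + 3 := by
  classical
  have hsub : (T.filter (fun I => I.1 = m)).filter (fun I => act c y I) ⊆
      (Finset.Icc (y / 2 ^ m - 1) (y / 2 ^ m + c + 1)).image (fun a => (m, a)) := by
    rintro ⟨m', a⟩ hI
    rw [Finset.mem_filter, Finset.mem_filter] at hI
    obtain ⟨⟨-, hm⟩, hI⟩ := hI
    unfold act at hI
    obtain ⟨h1, h2⟩ := hI
    simp only at hm h1 h2
    subst hm
    rw [Finset.mem_image]
    refine ⟨a, ?_, rfl⟩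
    have hL : 0 < 2 ^ m' := by positivity
    generalize 2 ^ m' = L at *
    have q1 : y / L < a + 2 := (Nat.div_lt_iff_lt_mul hL).2 h2
    have q2 : y < L * (y / L + 1) := Nat.lt_mul_div_succ y hL
    have q3 : a < y / L + 1 + c + 1 := by
      by_contra hcon
      push Not at hcon
      have : (y / L + 1 + c + 1) * L ≤ a * L := Nat.mul_le_mul_right L hcon
      have : c ≤ c * L := Nat.le_mul_of_pos_right c hL
      nlinarith
    rw [Finset.mem_Icc]; omega
  refine (Finset.card_le_card hsub).trans (Finset.card_image_le.trans ?_)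
  rw [Nat.card_Icc]; omega

lemma scale_part (T : Finset (ℕ × ℕ)) (N : ℕ) (hN : ∀ I ∈ T, I.1 < N) (f : ℕ × ℕ → ℝ) :
    ∑ m ∈ Finset.range N, ∑ I ∈ T.filter (fun I => I.1 = m), f I = ∑ I ∈ T, f I :=
  Finset.sum_fiberwise_of_maps_to (fun I hI => Finset.mem_range.2 (hN I hI)) f

lemma am_sum (r N : ℕ) : ∑ m ∈ Finset.range N, am r m ≤ 5 / 2 * am r N := by
  induction N with
  | zero => simp; exact am_nonneg _ _
  | succ N ih =>
    rw [Finset.sum_range_succ]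
    have := am_succ r N
    linarith

lemma sup_scale (T : Finset (ℕ × ℕ)) : ∃ N, (∀ I ∈ T, I.1 < N) ∧
    (T.Nonempty → ∃ I ∈ T, N = I.1 + 1) := by
  refine ⟨T.sup Prod.fst + 1, fun I hI => Nat.lt_succ_of_le (Finset.le_sup (f := Prod.fst) hI), ?_⟩
  intro h
  obtain ⟨I, hI, e⟩ := Finset.exists_mem_eq_sup T h Prod.fst
  exact ⟨I, hI, by rw [e]⟩

lemma S_bound (r : ℕ) (ρ : ℝ) (hρ : 0 < ρ) (T : Finset (ℕ × ℕ))
    (hT : ∀ I ∈ T, 6 * (2 : ℝ) ^ I.1 ≤ ρ) (y : ℕ) :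
    2 * ∑ I ∈ T, (if act 0 y I then 21 * am r I.1 else 0) ≤ 441 * (ρ ^ (r - 1) * Real.sqrt ρ) := by
  obtain ⟨N, hN, hN'⟩ := sup_scale T
  rcases T.eq_empty_or_nonempty with he | hne
  · rw [he]; simp; positivity
  · obtain ⟨I, hI, hNI⟩ := hN' hne
    have h2N : (2 : ℝ) ^ N ≤ ρ := by
      have := hT I hI
      rw [hNI, pow_succ]
      have : (0 : ℝ) < 2 ^ I.1 := by positivity
      linarith
    have ham : am r N ≤ ρ ^ (r - 1) * Real.sqrt ρ := by
      unfold am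
      gcongr
    rw [← scale_part T N hN]
    have : ∀ m ∈ Finset.range N, ∑ I ∈ T.filter (fun I => I.1 = m),
        (if act 0 y I then 21 * am r I.1 else 0) ≤ 63 * am r m := by
      intro m _
      rw [← Finset.sum_filter]
      have h1 : ∑ I ∈ (T.filter (fun I => I.1 = m)).filter (fun I => act 0 y I), 21 * am r I.1
          = ∑ I ∈ (T.filter (fun I => I.1 = m)).filter (fun I => act 0 y I), 21 * am r m := by
        apply Finset.sum_congr rfl
        intro I hI
        rw [(Finset.mem_filter.1 (Finset.mem_filter.1 hI).1).2]
      rw [h1, Finset.sum_const, nsmul_eq_mul]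
      have h2 : (((T.filter (fun I => I.1 = m)).filter (fun I => act 0 y I)).card : ℝ) ≤ 3 := by
        exact_mod_cast scale_count T 0 y m
      nlinarith [am_nonneg r m]
    have h3 := Finset.sum_le_sum this
    rw [← Finset.mul_sum] at h3
    have h4 := am_sum r N
    have : 0 ≤ ρ ^ (r - 1) * Real.sqrt ρ := by positivity
    linarith

/-- The ratio `1/√2`. -/
def tht : ℝ := (Real.sqrt 2)⁻¹

lemma tht_pos : 0 < tht := by unfold tht; positivity

lemma tht_lt : tht < 1 := by
  unfold tht
  apply inv_lt_one_of_one_lt₀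
  rw [Real.lt_sqrt (by norm_num)]; norm_num

lemma tht_sq (m : ℕ) : tht ^ m * tht ^ m * 2 ^ m = 1 := by
  rw [← mul_pow, ← mul_pow]
  have : tht * tht * 2 = 1 := by
    unfold tht
    rw [← mul_inv, Real.mul_self_sqrt (by norm_num)]; norm_num
  rw [this, one_pow]

lemma am_tht (r m : ℕ) (hr : 1 ≤ r) : am r m = tht ^ m * ((2 : ℝ) ^ m) ^ r := by
  have h : Real.sqrt ((2 : ℝ) ^ m) = tht ^ m * 2 ^ m := by
    have h1 : Real.sqrt ((2 : ℝ) ^ m) = Real.sqrt ((tht ^ m * 2 ^ m) ^ 2) := by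
      congr 1
      have := tht_sq m
      calc (2 : ℝ) ^ m = (tht ^ m * tht ^ m * 2 ^ m) * 2 ^ m := by rw [this, one_mul]
        _ = _ := by ring
    rw [h1, Real.sqrt_sq]
    have := tht_pos
    positivity
  unfold am
  rw [h]
  obtain ⟨k, rfl⟩ : ∃ k, r = k + 1 := ⟨r - 1, by omega⟩
  simp only [Nat.add_sub_cancel, pow_succ]
  ring

/-- Constant for the bumps. -/
def Db (r : ℕ) : ℝ := 21 * (2 * (r : ℝ)) ^ r

lemma Db_nonneg (r : ℕ) : 0 ≤ Db r := by unfold Db; positivity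

/-- Total constant for the bumps. -/
def C3 (r : ℕ) : ℝ := 2 * ((r + 3) * Db r) / (1 - tht) * (Db r * (r + 3))

lemma C3_nonneg (r : ℕ) : 0 ≤ C3 r := by
  unfold C3
  have := Db_nonneg r
  have : 0 < 1 - tht := by linarith [tht_lt]
  positivity

lemma act_card (n c : ℕ) (I : ℕ × ℕ) :
    ((Finset.range n).filter (fun i => act c i I)).card ≤ 3 * 2 ^ I.1 + c := by
  have hsub : (Finset.range n).filter (fun i => act c i I) ⊆
      Finset.Ico (I.2 * 2 ^ I.1 - (c + 2 ^ I.1)) ((I.2 + 2) * 2 ^ I.1) := by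
    intro i hi
    rw [Finset.mem_filter] at hi
    obtain ⟨-, hi⟩ := hi
    unfold act at hi
    rw [Finset.mem_Ico]; omega
  refine (Finset.card_le_card hsub).trans ?_
  rw [Nat.card_Ico]
  have : (I.2 + 2) * 2 ^ I.1 = I.2 * 2 ^ I.1 + 2 * 2 ^ I.1 := by ring
  omega

lemma bump_cost (r n : ℕ) (hr : 1 ≤ r) (T : Finset (ℕ × ℕ)) (φ : ℕ × ℕ → ℕ → ℝ) (e : ℕ × ℕ → ℝ)
    (he : ∀ I, |e I| ≤ 1) (hs : ∀ I y, φ I y ≠ 0 → act 0 y I)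
    (hd : ∀ I y, |(dL ^ r) (φ I) y| ≤ (2 * (r : ℝ)) ^ r / ((2 : ℝ) ^ I.1) ^ r) :
    ∑ i ∈ Finset.range n, (∑ I ∈ T, e I * (21 * am r I.1) * (dL ^ r) (φ I) i) ^ 2
      ≤ C3 r * T.card := by
  obtain ⟨N, hN, -⟩ := sup_scale T
  have hDb := Db_nonneg r
  have htp := tht_pos
  have h1t : 0 < 1 - tht := by linarith [tht_lt]
  set v : ℕ × ℕ → ℕ → ℝ := fun I i => if act r i I then Db r * tht ^ I.1 else 0 with hv
  have v0 : ∀ I i, 0 ≤ v I i := by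
    intro I i; simp only [hv]; split_ifs
    · positivity
    · exact le_rfl
  have hbd : ∀ I i, |e I * (21 * am r I.1) * (dL ^ r) (φ I) i| ≤ v I i := by
    intro I i
    simp only [hv]
    split_ifs with h
    · rw [abs_mul, abs_mul, abs_of_nonneg (mul_nonneg (by norm_num : (0:ℝ) ≤ 21) (am_nonneg r I.1))]
      have h1 : (21 * am r I.1) * |(dL ^ r) (φ I) i| ≤ Db r * tht ^ I.1 := by
        calc _ ≤ (21 * am r I.1) * ((2 * (r : ℝ)) ^ r / ((2 : ℝ) ^ I.1) ^ r) :=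
              mul_le_mul_of_nonneg_left (hd I i) (mul_nonneg (by norm_num) (am_nonneg _ _))
          _ = _ := by
              rw [am_tht r I.1 hr]; unfold Db; field_simp
      have h2 : 0 ≤ (21 * am r I.1) * |(dL ^ r) (φ I) i| :=
        mul_nonneg (mul_nonneg (by norm_num) (am_nonneg _ _)) (abs_nonneg _)
      rw [mul_assoc]
      calc _ ≤ 1 * ((21 * am r I.1) * |(dL ^ r) (φ I) i|) :=
            mul_le_mul_of_nonneg_right (he I) h2
        _ ≤ _ := by rw [one_mul]; exact h1
    · have : (dL ^ r) (φ I) i = 0 := by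
        apply dLp_zero_of
        intro x h1 h2
        by_contra hx
        apply h
        have := hs I x hx
        unfold act at *
        omega
      rw [this, mul_zero, abs_zero]
  have hpt : ∀ i, (∑ I ∈ T, e I * (21 * am r I.1) * (dL ^ r) (φ I) i) ^ 2
      ≤ 2 * ((r + 3) * Db r) / (1 - tht) * ∑ I ∈ T, v I i * tht ^ I.1 := by
    intro i
    have h1 : |∑ I ∈ T, e I * (21 * am r I.1) * (dL ^ r) (φ I) i| ≤ ∑ I ∈ T, v I i :=
      (Finset.abs_sum_le_sum_abs _ _).trans (Finset.sum_le_sum (fun I _ => hbd I i))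
    have h2 : (∑ I ∈ T, e I * (21 * am r I.1) * (dL ^ r) (φ I) i) ^ 2 ≤ (∑ I ∈ T, v I i) ^ 2 := by
      rw [← sq_abs]
      exact pow_le_pow_left₀ (abs_nonneg _) h1 2
    refine h2.trans ?_
    rw [← scale_part T N hN]
    refine (theta_lemma tht htp.le tht_lt N
      (fun m => ∑ I ∈ T.filter (fun I => I.1 = m), v I i) ((r + 3) * Db r) (by positivity)
      (fun m => Finset.sum_nonneg (fun I _ => v0 I i)) ?_).trans (le_of_eq ?_)
    · intro m
      simp only [hv]
      rw [← Finset.sum_filter]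
      have h1 : ∑ I ∈ (T.filter (fun I => I.1 = m)).filter (fun I => act r i I), Db r * tht ^ I.1
          = ∑ I ∈ (T.filter (fun I => I.1 = m)).filter (fun I => act r i I), Db r * tht ^ m := by
        apply Finset.sum_congr rfl
        intro I hI
        rw [(Finset.mem_filter.1 (Finset.mem_filter.1 hI).1).2]
      rw [h1, Finset.sum_const, nsmul_eq_mul, mul_assoc]
      apply mul_le_mul_of_nonneg_right _ (by positivity)
      exact_mod_cast scale_count T r i m
    · rw [← scale_part T N hN]
      congr 1
      refine Finset.sum_congr rfl (fun m _ => ?_)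
      rw [Finset.sum_mul]
      refine Finset.sum_congr rfl (fun I hI => ?_)
      rw [(Finset.mem_filter.1 hI).2]
  refine (Finset.sum_le_sum (fun i _ => hpt i)).trans ?_
  rw [← Finset.mul_sum, Finset.sum_comm]
  unfold C3
  rw [mul_assoc]
  apply mul_le_mul_of_nonneg_left _ (by positivity)
  have : ∀ I ∈ T, ∑ i ∈ Finset.range n, v I i * tht ^ I.1 ≤ Db r * (r + 3) := by
    intro I _
    rw [← Finset.sum_mul]
    simp only [hv]
    rw [← Finset.sum_filter, Finset.sum_const, nsmul_eq_mul]
    have h1 : (((Finset.range n).filter (fun i => act r i I)).card : ℝ) ≤ 3 * 2 ^ I.1 + r := by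
      exact_mod_cast act_card n r I
    have h2 : (1 : ℝ) ≤ 2 ^ I.1 := one_le_pow₀ (by norm_num)
    have h3 : (((Finset.range n).filter (fun i => act r i I)).card : ℝ) ≤ (r + 3) * 2 ^ I.1 := by
      nlinarith [Nat.cast_nonneg (α := ℝ) r]
    calc _ ≤ ((r + 3) * 2 ^ I.1) * (Db r * tht ^ I.1) * tht ^ I.1 := by gcongr
      _ = Db r * (r + 3) * (tht ^ I.1 * tht ^ I.1 * 2 ^ I.1) := by ring
      _ = _ := by rw [tht_sq, mul_one]
  refine (Finset.sum_le_sum this).trans ?_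
  rw [Finset.sum_const, nsmul_eq_mul]
  exact le_of_eq (by ring)

lemma noise_res (r n : ℕ) (T : Finset (ℕ × ℕ)) (Dr : Finset ℕ) (Q : ℕ × ℕ → ℕ → ℝ)
    (hcov : ∀ i < n, i ∈ Dr ∨ ∃ I ∈ T, I.2 * 2 ^ I.1 ≤ i ∧ i < (I.2 + 1) * 2 ^ I.1)
    (hdis : ∀ I ∈ T, ∀ J ∈ T, ∀ i, I.2 * 2 ^ I.1 ≤ i → i < (I.2 + 1) * 2 ^ I.1 →
        J.2 * 2 ^ J.1 ≤ i → i < (J.2 + 1) * 2 ^ J.1 → I = J)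
    (hQ : ∀ I, Q I ∈ supSub r (2 ^ I.1)) (z : ℕ → ℝ) :
    ∑ i ∈ Finset.range n, (z i - (dL ^ r) (∑ I ∈ T, shR (I.2 * 2 ^ I.1) (Q I)) i) ^ 2
      ≤ ∑ I ∈ T, ∑ j ∈ Finset.range (2 ^ I.1),
          (z (j + I.2 * 2 ^ I.1) - (dL ^ r) (Q I) j) ^ 2 + ∑ i ∈ Dr, z i ^ 2 := by
  classical
  have hzero : ∀ (I : ℕ × ℕ) (i : ℕ), ¬ (I.2 * 2 ^ I.1 ≤ i ∧ i < (I.2 + 1) * 2 ^ I.1) →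
      (dL ^ r) (shR (I.2 * 2 ^ I.1) (Q I)) i = 0 := by
    intro I i h
    by_cases h1 : i < I.2 * 2 ^ I.1
    · exact shR_dL_lo r _ _ (supSub_lo (hQ I)) i h1
    · obtain ⟨j, rfl⟩ : ∃ j, i = j + I.2 * 2 ^ I.1 := ⟨i - I.2 * 2 ^ I.1, by omega⟩
      rw [shR_dL_hi]
      apply supSub_dL_hi (hQ I)
      have : (I.2 + 1) * 2 ^ I.1 = I.2 * 2 ^ I.1 + 2 ^ I.1 := by ring
      omega
  set g : ℕ × ℕ → ℕ → ℝ := fun I i => if I.2 * 2 ^ I.1 ≤ i ∧ i < (I.2 + 1) * 2 ^ I.1 then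
    (z i - (dL ^ r) (shR (I.2 * 2 ^ I.1) (Q I)) i) ^ 2 else 0 with hg
  have g0 : ∀ I i, 0 ≤ g I i := by
    intro I i; simp only [hg]; split_ifs
    · exact sq_nonneg _
    · exact le_rfl
  have hpt : ∀ i ∈ Finset.range n, (z i - (dL ^ r) (∑ I ∈ T, shR (I.2 * 2 ^ I.1) (Q I)) i) ^ 2
      ≤ ∑ I ∈ T, g I i + if i ∈ Dr then z i ^ 2 else 0 := by
    intro i hi
    have hD0 : 0 ≤ if i ∈ Dr then z i ^ 2 else 0 := by
      split_ifs
      · exact sq_nonneg _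
      · exact le_rfl
    rw [map_sum, Finset.sum_apply]
    by_cases hex : ∃ I ∈ T, I.2 * 2 ^ I.1 ≤ i ∧ i < (I.2 + 1) * 2 ^ I.1
    · obtain ⟨I, hI, h1, h2⟩ := hex
      rw [Finset.sum_eq_single I]
      · have : g I i ≤ ∑ J ∈ T, g J i := Finset.single_le_sum (fun J _ => g0 J i) hI
        have h3 : g I i = (z i - (dL ^ r) (shR (I.2 * 2 ^ I.1) (Q I)) i) ^ 2 := by
          simp only [hg]; rw [if_pos ⟨h1, h2⟩]
        linarith
      · intro J hJ hne
        apply hzero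
        rintro ⟨h3, h4⟩
        exact hne (hdis J hJ I hI i h3 h4 h1 h2)
      · exact fun h => (h hI).elim
    · rw [Finset.sum_eq_zero]
      · rcases hcov i (Finset.mem_range.1 hi) with h | h
        · rw [if_pos h, sub_zero]
          linarith [Finset.sum_nonneg (fun I (_ : I ∈ T) => g0 I i)]
        · exact (hex h).elim
      · intro I hI
        apply hzero
        exact fun h => hex ⟨I, hI, h⟩
  refine (Finset.sum_le_sum hpt).trans ?_
  rw [Finset.sum_add_distrib, Finset.sum_comm]
  apply add_le_add
  · apply Finset.sum_le_sum
    intro I _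
    simp only [hg]
    rw [← Finset.sum_filter]
    calc _ ≤ ∑ i ∈ Finset.Ico (I.2 * 2 ^ I.1) ((I.2 + 1) * 2 ^ I.1),
          (z i - (dL ^ r) (shR (I.2 * 2 ^ I.1) (Q I)) i) ^ 2 := by
          apply Finset.sum_le_sum_of_subset_of_nonneg
          · intro i hi
            rw [Finset.mem_Ico]; exact (Finset.mem_filter.1 hi).2
          · intro i _ _; exact sq_nonneg _
      _ = _ := by
          rw [Finset.sum_Ico_eq_sum_range]
          have : (I.2 + 1) * 2 ^ I.1 - I.2 * 2 ^ I.1 = 2 ^ I.1 := by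
            rw [add_mul, one_mul, Nat.add_sub_cancel_left]
          rw [this]
          refine Finset.sum_congr rfl (fun j _ => ?_)
          rw [add_comm (I.2 * 2 ^ I.1) j, shR_dL_hi]
  · rw [← Finset.sum_filter]
    apply Finset.sum_le_sum_of_subset_of_nonneg
    · intro i hi; exact (Finset.mem_filter.1 hi).2
    · intro i _ _; exact sq_nonneg _

def Cchi (r : ℕ) : ℝ := 441 ^ 2 * (4 * (r : ℝ)) ^ (2 * (r - 1) + 1) * 2 ^ (2 * r) * (3 * r)

lemma Cchi_nonneg (r : ℕ) : 0 ≤ Cchi r := by unfold Cchi; positivity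

lemma chi_cost (r n w : ℕ) (hr : 1 ≤ r) (ρ : ℝ) (hρ : 0 < ρ) (hw : 1 ≤ w) (hρw : ρ ≤ 4 * r * w)
    (N : ℕ) (χ : ℕ → ℝ) (hd : ∀ y, |(dL ^ r) χ y| ≤ (2 / (w : ℝ)) ^ r) (S : Finset ℕ)
    (hS : (S.card : ℝ) ≤ N * (3 * r * w)) (hS0 : ∀ y, y ∉ S → (dL ^ r) χ y = 0) :
    ∑ i ∈ Finset.range n, (441 * (ρ ^ (r - 1) * √ρ) * (dL ^ r) χ i) ^ 2 ≤ Cchi r * N := by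
  have hw0 : (0 : ℝ) < w := by exact_mod_cast hw
  have e1 : ∀ i, (441 * (ρ ^ (r - 1) * √ρ) * (dL ^ r) χ i) ^ 2
      = 441 ^ 2 * ρ ^ (2 * (r - 1) + 1) * ((dL ^ r) χ i) ^ 2 := by
    intro i
    have : √ρ ^ 2 = ρ := Real.sq_sqrt hρ.le
    rw [mul_pow, mul_pow, mul_pow, this]; ring
  have e2 : ∑ i ∈ Finset.range n, ((dL ^ r) χ i) ^ 2 ≤ S.card * ((2 / (w : ℝ)) ^ r) ^ 2 := by
    calc ∑ i ∈ Finset.range n, ((dL ^ r) χ i) ^ 2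
        = ∑ i ∈ (Finset.range n).filter (· ∈ S), ((dL ^ r) χ i) ^ 2 := by
          rw [Finset.sum_filter]
          apply Finset.sum_congr rfl
          intro i _
          split_ifs with h
          · rfl
          · rw [hS0 i h]; norm_num
      _ ≤ ∑ i ∈ (Finset.range n).filter (· ∈ S), ((2 / (w : ℝ)) ^ r) ^ 2 := by
          apply Finset.sum_le_sum
          intro i _
          rw [← sq_abs]
          exact pow_le_pow_left₀ (abs_nonneg _) (hd i) 2
      _ ≤ S.card * ((2 / (w : ℝ)) ^ r) ^ 2 := by
          rw [Finset.sum_const, nsmul_eq_mul]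
          have : ((Finset.range n).filter (· ∈ S)).card ≤ S.card :=
            Finset.card_le_card (fun i hi => (Finset.mem_filter.1 hi).2)
          gcongr
  simp_rw [e1]
  rw [← Finset.mul_sum]
  calc 441 ^ 2 * ρ ^ (2 * (r - 1) + 1) * ∑ i ∈ Finset.range n, ((dL ^ r) χ i) ^ 2
      ≤ 441 ^ 2 * (4 * r * w) ^ (2 * (r - 1) + 1) * ((N * (3 * r * w)) * ((2 / (w : ℝ)) ^ r) ^ 2) := by
        have : ∑ i ∈ Finset.range n, ((dL ^ r) χ i) ^ 2
          ≤ (N * (3 * r * w)) * ((2 / (w : ℝ)) ^ r) ^ 2 := e2.trans (by gcongr)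
        gcongr
    _ = Cchi r * N := by
        unfold Cchi
        obtain ⟨k, rfl⟩ : ∃ k, r = k + 1 := ⟨r - 1, by omega⟩
        simp only [Nat.add_sub_cancel]
        rw [mul_pow _ (w : ℝ), div_pow, div_pow]
        field_simp
        ring

lemma sign_bound (lam c S P : ℝ) (hl : 2 * S ≤ lam) (hS : 0 ≤ S) (hP : |P| ≤ S) (hc : |c| ≤ 1)
    (U : ℝ) (hU : |U| ≤ S) (h1 : 0 < c → U = S) (h2 : c < 0 → U = -S) :
    |lam * c - U + P| ≤ lam := by
  have hl0 : 0 ≤ lam := by linarith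
  obtain ⟨p1, p2⟩ := abs_le.1 hP
  obtain ⟨c1, c2⟩ := abs_le.1 hc
  obtain ⟨u1, u2⟩ := abs_le.1 hU
  rw [abs_le]
  rcases lt_trichotomy c 0 with h | h | h
  · rw [h2 h]
    constructor <;> nlinarith
  · subst h
    constructor <;> linarith
  · rw [h1 h]
    constructor <;> nlinarith

set_option maxHeartbeats 2000000 in
lemma cert_lemma (r : ℕ) (hr : 1 ≤ r) : ∃ C : ℝ, 0 < C ∧ ∀ (n : ℕ) (σ : ℝ), 0 < σ → ∀ ρ : ℝ, 0 < ρ →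
    ∀ (X : Finset ℕ) (s : ℕ → ℝ),
    (∀ x ∈ X, r ≤ x ∧ x < n ∧ ρ ≤ x ∧ ρ + x ≤ n ∧ (s x = 1 ∨ s x = -1)) →
    (∀ x ∈ X, ∀ y ∈ X, x < y → s x ≠ s y → ρ + x ≤ y) →
    ∃ (lam : ℝ) (H : (Fin n → ℝ) → ℝ), 0 ≤ lam ∧
      BddE n σ H (C * (n / ρ + (X.card + 1) * (1 + Real.log (1 + ρ)))) ∧
      ∀ ξ, ∃ q : ℕ → ℝ, (∀ x, x < r → q x = 0) ∧ (∀ x, n ≤ x → q x = 0) ∧ (∀ x, |q x| ≤ lam) ∧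
        (∀ x ∈ X, q x = lam * s x) ∧
        ∑ i ∈ Finset.range n, (zt r σ ξ 0 i - (dL ^ r) q i) ^ 2 ≤ H ξ := by
  classical
  choose G hG1 hG2 using cell_lemma r hr
  choose φ hφ0 hφ1 hφ2 hφ3 hφ4 using fun I : ℕ × ℕ => bump_lemma r hr I.1 I.2
  have c2 := C2_nonneg r
  have c3 := C3_nonneg r
  have cchi := Cchi_nonneg r
  refine ⟨3 * ((C2 r + C3 r + 4) * (12 * r + 31) + Cchi r), by positivity, ?_⟩
  intro n σ hσ ρ hρ X s hX hsep
  obtain ⟨T, Dr, hT1, hT2, hT3, hT4, hT5⟩ := geo_lemma r n ρ hρ X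
  obtain ⟨χ, w, hw, hρw, χ1, χX, χp, χm, χlo, χhi, χd, S, hS, hS0⟩ := chi_lemma r n ρ hρ hr X s hX hsep
  set lam : ℝ := 441 * (ρ ^ (r - 1) * √ρ) with hlam
  set e : ℕ × ℕ → ℝ := fun I => if ∃ y, act 0 y I ∧ 0 < χ y then 1 else -1 with he
  have he1 : ∀ I, |e I| ≤ 1 := by
    intro I; simp only [he]; split_ifs <;> simp
  have hact : ∀ I y, φ I y ≠ 0 → act 0 y I := by
    intro I y h
    have := hφ3 I y h
    exact ⟨by simpa using this.1, this.2⟩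
  have hepos : ∀ I y, act 0 y I → 0 < χ y → e I = 1 := by
    intro I y h1 h2
    simp only [he]
    rw [if_pos ⟨y, h1, h2⟩]
  have heneg : ∀ I ∈ T, ∀ y, act 0 y I → χ y < 0 → e I = -1 := by
    intro I hI y h1 h2
    simp only [he]
    rw [if_neg]
    rintro ⟨y', h3, h4⟩
    obtain ⟨x, hx, sx, dx⟩ := χm y h2
    obtain ⟨x', hx', sx', dx'⟩ := χp y' h4
    have hne : x ≠ x' := by
      rintro rfl; rw [sx] at sx'; norm_num at sx'
    have hL := hT1 I hI
    unfold act at h1 h3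
    have a1 : ((I.2 : ℝ)) * 2 ^ I.1 ≤ y + 2 ^ I.1 := by exact_mod_cast (by simpa using h1.1 : I.2 * 2 ^ I.1 ≤ y + 2 ^ I.1)
    have a2 : (y : ℝ) < (I.2 + 2) * 2 ^ I.1 := by exact_mod_cast h1.2
    have a3 : ((I.2 : ℝ)) * 2 ^ I.1 ≤ y' + 2 ^ I.1 := by exact_mod_cast (by simpa using h3.1 : I.2 * 2 ^ I.1 ≤ y' + 2 ^ I.1)
    have a4 : (y' : ℝ) < (I.2 + 2) * 2 ^ I.1 := by exact_mod_cast h3.2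
    obtain ⟨b1, b2⟩ := abs_le.1 dx
    obtain ⟨b3, b4⟩ := abs_le.1 dx'
    rcases lt_or_gt_of_ne hne with h | h
    · have := hsep x hx x' hx' h (by rw [sx, sx']; norm_num)
      nlinarith
    · have := hsep x' hx' x hx h (by rw [sx, sx']; norm_num)
      nlinarith
  have hφz : ∀ I ∈ T, ∀ y, (y < r ∨ n ≤ y ∨ y ∈ X) → φ I y = 0 := by
    intro I hI y hy
    by_contra hne
    have h := hφ3 I y hne
    have := hT2 I hI y h.1 h.2
    rcases hy with h | h | h
    · omega
    · omega
    · exact this.2.2 h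
  refine ⟨lam, fun ξ => 3 * ((∑ I ∈ T, G I.1 (zt r σ ξ (I.2 * 2 ^ I.1)))
      + ∑ i ∈ Dr, 2 * Real.cosh (∑ j ∈ Finset.range 1, 1 * zt r σ ξ i j))
      + 3 * (Cchi r * X.card + C3 r * T.card), by positivity, ?_, ?_⟩
  · have b1 : BddE n σ (fun ξ => ∑ I ∈ T, G I.1 (zt r σ ξ (I.2 * 2 ^ I.1))) (∑ I ∈ T, C2 r) :=
      BddE.sum T (fun I _ => hG2 I.1 n σ hσ _)
    have b2 : BddE n σ (fun ξ => ∑ i ∈ Dr, 2 * Real.cosh (∑ j ∈ Finset.range 1, 1 * zt r σ ξ i j))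
        (∑ i ∈ Dr, 2 * 2) :=
      BddE.sum Dr (fun i _ => BddE.mul (by norm_num) (cosh_bdd r n σ hσ 1 i (fun _ => 1) (by simp)))
    have b3 := (BddE.mul (by norm_num : (0 : ℝ) ≤ 3) (b1.add b2)).add
      (BddE.const n σ (3 * (Cchi r * X.card + C3 r * T.card)))
    refine ⟨b3.1, b3.2.trans ?_⟩
    simp only [Finset.sum_const, nsmul_eq_mul]
    set M : ℝ := n / ρ + (X.card + 1) * (1 + Real.log (1 + ρ)) with hM
    have hlog : 0 ≤ Real.log (1 + ρ) := Real.log_nonneg (by linarith)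
    have hMX : (X.card : ℝ) ≤ M := by
      have : 0 ≤ (n : ℝ) / ρ := by positivity
      have : 0 ≤ (X.card : ℝ) * Real.log (1 + ρ) := by positivity
      rw [hM]; nlinarith
    have t0 : (0 : ℝ) ≤ T.card := by positivity
    have d0 : (0 : ℝ) ≤ Dr.card := by positivity
    have k1 : (C2 r + C3 r + 4) * (T.card + Dr.card) ≤ (C2 r + C3 r + 4) * ((12 * r + 31) * M) := by
      gcongr
    have k2 : Cchi r * X.card ≤ Cchi r * M := by gcongr
    have k3 : 0 ≤ (C2 r + C3 r) * Dr.card + 4 * T.card := by positivity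
    linarith
  · intro ξ
    choose Q hQ1 hQ2 hQ3 using fun I : ℕ × ℕ => hG1 I.1 (zt r σ ξ (I.2 * 2 ^ I.1))
    have hsh : ∀ I y, |shR (I.2 * 2 ^ I.1) (Q I) y| ≤ 21 * am r I.1 * φ I y := by
      intro I y
      have am0 := am_nonneg r I.1
      have f0 := hφ0 I y
      have hr0 : 0 ≤ 21 * am r I.1 * φ I y := by positivity
      simp only [shR]
      split_ifs with h
      · simpa using hr0
      · push Not at h
        by_cases h2 : y < (I.2 + 1) * 2 ^ I.1
        · rw [hφ2 I y h h2, mul_one]; exact hQ2 I _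
        · rw [supSub_hi (hQ1 I) _ (by push Not at h2; rw [add_mul] at h2; omega)]
          simpa using hr0
    set P : ℕ → ℝ := ∑ I ∈ T, shR (I.2 * 2 ^ I.1) (Q I) with hP
    set U : ℕ → ℝ := ∑ I ∈ T, (e I * (21 * am r I.1)) • φ I with hU
    have hPy : ∀ y, P y = ∑ I ∈ T, shR (I.2 * 2 ^ I.1) (Q I) y := by
      intro y; rw [hP, Finset.sum_apply]
    have hUy : ∀ y, U y = ∑ I ∈ T, e I * (21 * am r I.1 * φ I y) := by
      intro y; rw [hU, Finset.sum_apply]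
      apply Finset.sum_congr rfl
      intro I _
      simp only [Pi.smul_apply, smul_eq_mul]; ring
    have hz : ∀ y, (y < r ∨ n ≤ y ∨ y ∈ X) → P y = 0 ∧ U y = 0 := by
      intro y hy
      constructor
      · rw [hPy]
        apply Finset.sum_eq_zero
        intro I hI
        have := hsh I y
        rw [hφz I hI y hy, mul_zero] at this
        exact abs_nonpos_iff.1 this
      · rw [hUy]
        apply Finset.sum_eq_zero
        intro I hI
        rw [hφz I hI y hy]; ring
    refine ⟨lam • χ - U + P, ?_, ?_, ?_, ?_, ?_⟩
    · intro x hx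
      have := hz x (Or.inl hx)
      simp only [Pi.add_apply, Pi.sub_apply, Pi.smul_apply, smul_eq_mul, this.1, this.2, χlo x hx]; ring
    · intro x hx
      have := hz x (Or.inr (Or.inl hx))
      simp only [Pi.add_apply, Pi.sub_apply, Pi.smul_apply, smul_eq_mul, this.1, this.2, χhi x hx]; ring
    · intro y
      simp only [Pi.add_apply, Pi.sub_apply, Pi.smul_apply, smul_eq_mul]
      have a0 : ∀ I, 0 ≤ 21 * am r I.1 * φ I y := by
        intro I
        have am0 := am_nonneg r I.1
        have f0 := hφ0 I y
        positivity
      apply sign_bound lam (χ y) (∑ I ∈ T, 21 * am r I.1 * φ I y) (P y) _ _ _ (χ1 y)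
      · rw [hUy]
        refine (Finset.abs_sum_le_sum_abs _ _).trans (Finset.sum_le_sum fun I _ => ?_)
        rw [abs_mul, abs_of_nonneg (a0 I)]
        exact mul_le_of_le_one_left (a0 I) (he1 I)
      · intro hc
        rw [hUy]
        apply Finset.sum_congr rfl
        intro I hI
        by_cases h : φ I y = 0
        · rw [h]; ring
        · rw [hepos I y (hact I y h) hc]; ring
      · intro hc
        rw [hUy, ← Finset.sum_neg_distrib]
        apply Finset.sum_congr rfl
        intro I hI
        by_cases h : φ I y = 0
        · rw [h]; ring
        · rw [heneg I hI y (hact I y h) hc]; ring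
      · refine le_trans ?_ (S_bound r ρ hρ T hT1 y)
        gcongr with I hI
        have am0 := am_nonneg r I.1
        split_ifs with h
        · exact mul_le_of_le_one_right (by positivity) (hφ1 I y)
        · have : φ I y = 0 := by by_contra hne; exact h (hact I y hne)
          rw [this]; simp
      · exact Finset.sum_nonneg fun I _ => a0 I
      · rw [hPy]
        exact (Finset.abs_sum_le_sum_abs _ _).trans (Finset.sum_le_sum fun I _ => hsh I y)
    · intro x hx
      have := hz x (Or.inr (Or.inr hx))
      simp only [Pi.add_apply, Pi.sub_apply, Pi.smul_apply, smul_eq_mul, this.1, this.2, χX x hx]; ring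
    · have n1 := noise_res r n T Dr Q hT3 hT4 hQ1 (zt r σ ξ 0)
      rw [← hP] at n1
      have n2 := bump_cost r n hr T φ e he1 hact hφ4
      have n3 := chi_cost r n w hr ρ hρ hw hρw X.card χ χd S hS hS0
      have n4 : ∑ I ∈ T, ∑ j ∈ Finset.range (2 ^ I.1),
          (zt r σ ξ 0 (j + I.2 * 2 ^ I.1) - (dL ^ r) (Q I) j) ^ 2
          ≤ ∑ I ∈ T, G I.1 (zt r σ ξ (I.2 * 2 ^ I.1)) := by
        apply Finset.sum_le_sum
        intro I _
        refine le_trans (le_of_eq ?_) (hQ3 I)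
        apply Finset.sum_congr rfl
        intro j _
        have := congrFun (zt_shift r σ ξ 0 (I.2 * 2 ^ I.1)) j
        simp only [zero_add] at this
        rw [this]
      have n5 : ∑ i ∈ Dr, zt r σ ξ 0 i ^ 2
          ≤ ∑ i ∈ Dr, 2 * Real.cosh (∑ j ∈ Finset.range 1, 1 * zt r σ ξ i j) := by
        apply Finset.sum_le_sum
        intro i _
        have : ∑ j ∈ Finset.range 1, 1 * zt r σ ξ i j = zt r σ ξ 0 i := by simp [zt]
        rw [this]
        exact sq_le_cosh _
      have hUd : ∀ i, (dL ^ r) U i = ∑ I ∈ T, e I * (21 * am r I.1) * (dL ^ r) (φ I) i := by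
        intro i
        rw [hU, map_sum, Finset.sum_apply]
        apply Finset.sum_congr rfl
        intro I _
        rw [map_smul]; rfl
      have key : ∀ i, (zt r σ ξ 0 i - (dL ^ r) (lam • χ - U + P) i) ^ 2
          ≤ 3 * (zt r σ ξ 0 i - (dL ^ r) P i) ^ 2 + 3 * (lam * (dL ^ r) χ i) ^ 2
            + 3 * (∑ I ∈ T, e I * (21 * am r I.1) * (dL ^ r) (φ I) i) ^ 2 := by
        intro i
        have : (dL ^ r) (lam • χ - U + P) i = lam * (dL ^ r) χ i - (dL ^ r) U i + (dL ^ r) P i := by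
          rw [map_add, map_sub, map_smul]; rfl
        rw [this, ← hUd]
        generalize zt r σ ξ 0 i = a
        generalize (dL ^ r) P i = b
        generalize lam * (dL ^ r) χ i = c
        generalize (dL ^ r) U i = d
        nlinarith [sq_nonneg ((a - b) + c), sq_nonneg ((a - b) - d), sq_nonneg (c + d)]
      refine (Finset.sum_le_sum fun i _ => key i).trans ?_
      rw [Finset.sum_add_distrib, Finset.sum_add_distrib, ← Finset.mul_sum, ← Finset.mul_sum,
        ← Finset.mul_sum]
      simp only []
      linarith

lemma pad_coe {n : ℕ} (x : Fin n → ℝ) (i : Fin n) : pad x i = x i := by simp [pad]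

lemma DD_eq (r : ℕ) {n : ℕ} (x : Fin n → ℝ) (t : ℕ) : DD r x t = (dL ^ r) (pad x) t := by
  rw [dLp_eq]; rfl

lemma pad_add {n : ℕ} (x y : Fin n → ℝ) : pad (x + y) = pad x + pad y := by
  funext t; simp only [pad, Pi.add_apply]; split_ifs <;> simp

lemma pad_smul {n : ℕ} (c : ℝ) (x : Fin n → ℝ) : pad (c • x) = c • pad x := by
  funext t; simp only [pad, Pi.smul_apply, smul_eq_mul]; split_ifs <;> simp

lemma DD_add (r : ℕ) {n : ℕ} (x y : Fin n → ℝ) (t : ℕ) : DD r (x + y) t = DD r x t + DD r y t := by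
  rw [DD_eq, DD_eq, DD_eq, pad_add, map_add]; rfl

lemma DD_smul (r : ℕ) {n : ℕ} (c : ℝ) (x : Fin n → ℝ) (t : ℕ) : DD r (c • x) t = c * DD r x t := by
  rw [DD_eq, DD_eq, pad_smul, map_smul]; rfl

lemma Dl1_add (r : ℕ) {n : ℕ} (x y : Fin n → ℝ) : Dl1 r (x + y) ≤ Dl1 r x + Dl1 r y := by
  unfold Dl1
  rw [← Finset.sum_add_distrib]
  apply Finset.sum_le_sum
  intro t _
  rw [DD_add]; exact abs_add_le _ _

lemma Dl1_smul (r : ℕ) {n : ℕ} (c : ℝ) (x : Fin n → ℝ) : Dl1 r (c • x) = |c| * Dl1 r x := by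
  unfold Dl1
  rw [Finset.mul_sum]
  apply Finset.sum_congr rfl
  intro t _
  rw [DD_smul, abs_mul]

lemma Dl1_nonneg (r : ℕ) {n : ℕ} (x : Fin n → ℝ) : 0 ≤ Dl1 r x :=
  Finset.sum_nonneg fun _ _ => abs_nonneg _

lemma proj_var {r n : ℕ} {V : ℝ} {y h θ : Fin n → ℝ} (hh : h ∈ Kset r n V) (hθ : θ ∈ Kset r n V)
    (hmin : ∀ θ ∈ Kset r n V, sqnorm (y - h) ≤ sqnorm (y - θ)) :
    0 ≤ ∑ i, (y i - h i) * (h i - θ i) := by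
  by_contra hneg
  push Not at hneg
  set A := ∑ i, (y i - h i) * (h i - θ i) with hA
  set B := ∑ i, (h i - θ i) ^ 2 with hB
  have hB0 : 0 ≤ B := Finset.sum_nonneg fun _ _ => sq_nonneg _
  have key : ∀ t : ℝ, 0 ≤ t → t ≤ 1 → 0 ≤ 2 * t * A + t ^ 2 * B := by
    intro t h0 h1
    have hm : (1 - t) • h + t • θ ∈ Kset r n V := by
      show Dl1 r _ ≤ _
      have a1 := Dl1_add r ((1 - t) • h) (t • θ)
      rw [Dl1_smul, Dl1_smul, abs_of_nonneg h0, abs_of_nonneg (by linarith : 0 ≤ 1 - t)] at a1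
      have a2 : Dl1 r h ≤ _ := hh
      have a3 : Dl1 r θ ≤ _ := hθ
      nlinarith
    have := hmin _ hm
    have e : sqnorm (y - ((1 - t) • h + t • θ)) = sqnorm (y - h) + (2 * t * A + t ^ 2 * B) := by
      unfold sqnorm
      rw [hA, hB, Finset.mul_sum, Finset.mul_sum, ← Finset.sum_add_distrib, ← Finset.sum_add_distrib]
      apply Finset.sum_congr rfl
      intro i _
      simp only [Pi.sub_apply, Pi.add_apply, Pi.smul_apply, smul_eq_mul]
      ring
    linarith
  have hpos : 0 < B - A := by linarith
  have := key (-A / (B - A)) (div_nonneg (by linarith) hpos.le) ((div_le_one hpos).2 (by linarith))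
  have e2 : 2 * (-A / (B - A)) * A + (-A / (B - A)) ^ 2 * B = (-A) ^ 2 * (2 * A - B) / (B - A) ^ 2 := by
    field_simp
    ring
  rw [e2] at this
  have : (-A) ^ 2 * (2 * A - B) / (B - A) ^ 2 < 0 := by
    apply div_neg_of_neg_of_pos
    · apply mul_neg_of_pos_of_neg
      · apply pow_pos; linarith
      · linarith
    · positivity
  linarith

lemma dual_ineq (r n : ℕ) (h θ0 : Fin n → ℝ) (q : ℕ → ℝ) (lam : ℝ) (hl : 0 ≤ lam)
    (hle : Dl1 r h ≤ Dl1 r θ0) (q1 : ∀ x, x < r → q x = 0) (q2 : ∀ x, n ≤ x → q x = 0)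
    (q3 : ∀ x, |q x| ≤ lam) (q4 : ∀ t < n - r, q (t + r) * DD r θ0 t = lam * |DD r θ0 t|) :
    ∑ i : Fin n, ((-1) ^ r * (dL ^ r) q i) * (h i - θ0 i) ≤ 0 := by
  have e1 : ∑ i : Fin n, ((-1) ^ r * (dL ^ r) q i) * (h i - θ0 i)
      = (-1) ^ r * ∑ i ∈ Finset.range n, (pad h - pad θ0) i * (dL ^ r) q i := by
    rw [← Fin.sum_univ_eq_sum_range (fun i => (pad h - pad θ0) i * (dL ^ r) q i) n, Finset.mul_sum]
    apply Finset.sum_congr rfl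
    intro i _
    rw [Pi.sub_apply, pad_coe, pad_coe]; ring
  rw [e1, ← sum_by_parts r n _ q q1 q2]
  have e2 : ∑ t ∈ Finset.range n, q (t + r) * (dL ^ r) (pad h - pad θ0) t
      = ∑ t ∈ Finset.range (n - r), q (t + r) * (DD r h t - DD r θ0 t) := by
    symm
    have : ∀ t, q (t + r) * (DD r h t - DD r θ0 t) = q (t + r) * (dL ^ r) (pad h - pad θ0) t := by
      intro t; rw [DD_eq, DD_eq, map_sub]; rfl
    simp_rw [this]
    apply Finset.sum_subset
    · intro x; simp only [Finset.mem_range]; omega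
    · intro x hx hx'
      simp only [Finset.mem_range] at hx hx'
      rw [q2 _ (by omega)]; ring
  rw [e2]
  have : ∑ t ∈ Finset.range (n - r), q (t + r) * (DD r h t - DD r θ0 t)
      ≤ ∑ t ∈ Finset.range (n - r), (lam * |DD r h t| - lam * |DD r θ0 t|) := by
    apply Finset.sum_le_sum
    intro t ht
    rw [mul_sub, q4 t (Finset.mem_range.1 ht)]
    have : q (t + r) * DD r h t ≤ lam * |DD r h t| := by
      refine (le_abs_self _).trans ?_
      rw [abs_mul]
      exact mul_le_mul_of_nonneg_right (q3 _) (abs_nonneg _)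
    linarith
  refine this.trans ?_
  rw [Finset.sum_sub_distrib, ← Finset.mul_sum, ← Finset.mul_sum]
  unfold Dl1 at hle
  have := mul_le_mul_of_nonneg_left hle hl
  linarith

lemma det_ineq (r n : ℕ) (σ V : ℝ) (hσ : 0 < σ) (est : (Fin n → ℝ) → Fin n → ℝ)
    (hest : IsProjOn est (Kset r n V)) (θ0 θs ξ : Fin n → ℝ)
    (h0 : Dl1 r θ0 = V * (n : ℝ) ^ (1 - (r : ℤ)))
    (q : ℕ → ℝ) (lam : ℝ) (hl : 0 ≤ lam) (q1 : ∀ x, x < r → q x = 0) (q2 : ∀ x, n ≤ x → q x = 0)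
    (q3 : ∀ x, |q x| ≤ lam) (q4 : ∀ t < n - r, q (t + r) * DD r θ0 t = lam * |DD r θ0 t|) :
    sqnorm (est (θs + ξ) - θs) ≤ sqnorm (θ0 - θs)
      + σ ^ 2 * ∑ i ∈ Finset.range n, (zt r σ ξ 0 i - (dL ^ r) q i) ^ 2 := by
  obtain ⟨hK, hmin⟩ := hest (θs + ξ)
  set h := est (θs + ξ) with hh
  have hθ0 : θ0 ∈ Kset r n V := h0.le
  have v1 := proj_var hK hθ0 hmin
  have v2 := dual_ineq r n h θ0 q lam hl (by rw [h0]; exact hK) q1 q2 q3 q4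
  have v3 := mul_le_mul_of_nonneg_left v2 hσ.le
  rw [mul_zero] at v3
  rw [← Fin.sum_univ_eq_sum_range (fun i => (zt r σ ξ 0 i - (dL ^ r) q i) ^ 2) n, Finset.mul_sum]
  unfold sqnorm
  rw [← Finset.sum_add_distrib]
  have key : ∀ i : Fin n, (h - θs) i ^ 2 ≤ (θ0 - θs) i ^ 2 + σ ^ 2 * (zt r σ ξ 0 i - (dL ^ r) q i) ^ 2
      + 2 * (σ * ((-1) ^ r * (dL ^ r) q i * (h i - θ0 i))) - 2 * (((θs + ξ) i - h i) * (h i - θ0 i)) := by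
    intro i
    have hs : ((-1 : ℝ) ^ r) ^ 2 = 1 := by rw [← pow_mul, mul_comm, pow_mul]; norm_num
    have hz : zt r σ ξ 0 i = (-1) ^ r / σ * ξ i := by
      simp only [zt, add_zero, pad_coe]
    have : σ ^ 2 * (zt r σ ξ 0 i - (dL ^ r) q i) ^ 2 = (ξ i - σ * ((-1) ^ r * (dL ^ r) q i)) ^ 2 := by
      rw [hz]
      have : σ * ((-1) ^ r / σ * ξ i - (dL ^ r) q i)
        = (-1) ^ r * (ξ i - σ * ((-1) ^ r * (dL ^ r) q i)) := by
        have h2 : (-1 : ℝ) ^ r * (ξ i - σ * ((-1) ^ r * (dL ^ r) q i))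
          = (-1) ^ r * ξ i - σ * (((-1) ^ r) ^ 2 * (dL ^ r) q i) := by ring
        rw [h2, hs]
        field_simp
      rw [← mul_pow, this, mul_pow, hs, one_mul]
    rw [this]
    simp only [Pi.sub_apply, Pi.add_apply]
    have e3 : σ * ((-1) ^ r * (dL ^ r) q i * (h i - θ0 i)) = σ * ((-1) ^ r * (dL ^ r) q i) * (h i - θ0 i) := by ring
    rw [e3]
    generalize σ * ((-1) ^ r * (dL ^ r) q ↑i) = v
    nlinarith [sq_nonneg (ξ i - v - (h i - θ0 i))]
  have := Finset.sum_le_sum fun (i : Fin n) (_ : i ∈ Finset.univ) => key i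
  rw [Finset.sum_sub_distrib, Finset.sum_add_distrib, ← Finset.mul_sum, ← Finset.mul_sum,
    ← Finset.mul_sum] at this
  linarith

lemma comparator (r n : ℕ) (hr : 1 ≤ r) (hrn : r ≤ n) (θs : Fin n → ℝ) (a : ℕ → ℝ)
    (ha : ∀ t, n - r ≤ t → a t = 0) :
    ∃ θ0 : Fin n → ℝ, (∀ t < n - r, DD r θ0 t = DD r θs t + a t) ∧
      sqnorm (θ0 - θs) ≤ n * ((n : ℝ) ^ (r - 1) * ∑ t ∈ Finset.range (n - r), |a t|) ^ 2 := by
  obtain ⟨g, g1, g2⟩ := exists_antidiff n a (r - 1)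
  rw [Nat.sub_add_cancel hr] at g1
  have es : ∑ t ∈ Finset.range n, |a t| = ∑ t ∈ Finset.range (n - r), |a t| := by
    symm
    apply Finset.sum_subset
    · intro x; simp only [Finset.mem_range]; omega
    · intro x _ hx'
      simp only [Finset.mem_range] at hx'
      rw [ha _ (by omega), abs_zero]
  rw [es] at g2
  refine ⟨θs + fun i : Fin n => g i, ?_, ?_⟩
  · intro t ht
    rw [DD_add]
    congr 1
    rw [DD_eq, ← g1 t]
    apply dLp_congr
    intro x _ hx
    simp only [pad]
    rw [dif_pos (by omega)]
  · unfold sqnorm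
    calc ∑ i : Fin n, ((θs + fun i : Fin n => g i) - θs) i ^ 2
        ≤ ∑ i : Fin n, ((n : ℝ) ^ (r - 1) * ∑ t ∈ Finset.range (n - r), |a t|) ^ 2 := by
          apply Finset.sum_le_sum
          intro i _
          simp only [Pi.sub_apply, Pi.add_apply, add_sub_cancel_left]
          rw [← sq_abs]
          exact pow_le_pow_left₀ (abs_nonneg _) (g2 i i.2.le) 2
      _ = _ := by simp

lemma main_risk (r : ℕ) (hr : 1 ≤ r) : ∃ C : ℝ, 0 < C ∧ ∀ (n : ℕ), 0 < n → ∀ (σ : ℝ), 0 < σ →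
    ∀ ρ : ℝ, 0 < ρ → ∀ (X : Finset ℕ) (s : ℕ → ℝ),
    (∀ x ∈ X, r ≤ x ∧ x < n ∧ ρ ≤ x ∧ ρ + x ≤ n ∧ (s x = 1 ∨ s x = -1)) →
    (∀ x ∈ X, ∀ y ∈ X, x < y → s x ≠ s y → ρ + x ≤ y) →
    ∀ (V W : ℝ) (est : (Fin n → ℝ) → Fin n → ℝ), IsProjOn est (Kset r n V) → ∀ θ0 θs : Fin n → ℝ,
    Dl1 r θ0 = V * (n : ℝ) ^ (1 - (r : ℤ)) → sqnorm (θ0 - θs) ≤ n * W ^ 2 →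
    (∀ t < n - r, DD r θ0 t ≠ 0 → t + r ∈ X ∧ s (t + r) * DD r θ0 t = |DD r θ0 t|) →
    risk σ est θs ≤ W ^ 2 + σ ^ 2 / n * (C * (n / ρ + (X.card + 1) * (1 + Real.log (1 + ρ)))) := by
  obtain ⟨C, hC, hcert⟩ := cert_lemma r hr
  refine ⟨C, hC, ?_⟩
  intro n hn σ hσ ρ hρ X s hX hsep V W est hest θ0 θs h0 hd hsgn
  obtain ⟨lam, H, hl, hH, hq⟩ := hcert n σ hσ ρ hρ X s hX hsep
  have hn0 : (0 : ℝ) < n := by exact_mod_cast hn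
  have pw : ∀ ξ, sqnorm (est (θs + ξ) - θs) ≤ n * W ^ 2 + σ ^ 2 * H ξ := by
    intro ξ
    obtain ⟨q, q1, q2, q3, q4, q5⟩ := hq ξ
    have := det_ineq r n σ V hσ est hest θ0 θs ξ h0 q lam hl q1 q2 q3 (by
      intro t ht
      by_cases hz : DD r θ0 t = 0
      · rw [hz]; simp
      · obtain ⟨m1, m2⟩ := hsgn t ht hz
        rw [q4 _ m1, mul_assoc, m2])
    have := mul_le_mul_of_nonneg_left q5 (sq_nonneg σ)
    linarith
  have hb := (BddE.const n σ (n * W ^ 2)).add (BddE.mul (sq_nonneg σ) hH)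
  have hintegral : ∫ ξ, sqnorm (est (θs + ξ) - θs) ∂gaussVec n σ
      ≤ ∫ ξ, (n * W ^ 2 + σ ^ 2 * H ξ) ∂gaussVec n σ := by
    apply integral_mono_of_nonneg
    · exact Filter.Eventually.of_forall fun ξ => Finset.sum_nonneg fun _ _ => sq_nonneg _
    · exact hb.1
    · exact Filter.Eventually.of_forall pw
  have h2 := hintegral.trans hb.2
  unfold risk
  have h3 := mul_le_mul_of_nonneg_left h2 (by positivity : 0 ≤ 1 / (n : ℝ))
  refine h3.trans (le_of_eq ?_)
  field_simp

lemma DD_succ (r : ℕ) (hr : 1 ≤ r) {n : ℕ} (x : Fin n → ℝ) (t : ℕ) :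
    DD r x t = DD (r - 1) x (t + 1) - DD (r - 1) x t := by
  obtain ⟨k, rfl⟩ : ∃ k, r = k + 1 := ⟨r - 1, by omega⟩
  simp only [DD, Nat.add_sub_cancel, Function.iterate_succ_apply']
  rfl

/-- sign function read off from the `r`-th differences -/
def sgn (r : ℕ) {n : ℕ} (θ : Fin n → ℝ) (x : ℕ) : ℝ := if 0 < DD r θ (x - r) then 1 else -1

/-- shifted knot set -/
def knotX (r : ℕ) {n : ℕ} (θ : Fin n → ℝ) : Finset ℕ :=
  ((Finset.range (n - r)).filter fun t => DD r θ t ≠ 0).image (fun t => t + r)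

lemma knotX_card (r : ℕ) {n : ℕ} (θ : Fin n → ℝ) : (knotX r θ).card = Dl0 r θ := by
  unfold knotX Dl0
  rw [Finset.card_image_of_injective _ (fun a b h => by simpa using h)]

lemma knot_of {r n : ℕ} (hr : 1 ≤ r) {θ : Fin n → ℝ} {k : ℕ} {j : Fin k → ℕ} {sg : Fin k → ℝ}
    (h : IsKnotSeq r n θ k j sg) (t : ℕ) (ht : t < n - r) (hne : DD r θ t ≠ 0) :
    ∃ i, j i = t + 2 ∧ sg i = sgn r θ (t + r) := by
  obtain ⟨-, -, h3, h4⟩ := h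
  rw [DD_succ r hr] at hne
  obtain ⟨i, hi⟩ := (h3 (t + 2) (by omega) (by omega)).1 (by
    simp only [Nat.add_sub_cancel]
    intro he
    apply hne
    rw [show t + 2 - 1 = t + 1 by omega] at he
    rw [he]; ring)
  refine ⟨i, hi, ?_⟩
  rw [h4 i, hi]
  unfold sgn
  rw [Nat.add_sub_cancel, Nat.add_sub_cancel, show t + 2 - 1 = t + 1 by omega, DD_succ r hr]
  simp only [sub_pos]

lemma knot_count {r n : ℕ} (hr : 1 ≤ r) {θ : Fin n → ℝ} {k : ℕ} {j : Fin k → ℕ}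
    {sg : Fin k → ℝ} (h : IsKnotSeq r n θ k j sg) : Dl0 r θ = k := by
  have h' := h
  obtain ⟨h1, h2, h3, h4⟩ := h
  unfold Dl0
  have : ((Finset.range (n - r)).filter fun t => DD r θ t ≠ 0)
      = Finset.univ.image (fun i => j i - 2) := by
    ext t
    rw [Finset.mem_filter, Finset.mem_image, Finset.mem_range]
    constructor
    · rintro ⟨a, b⟩
      obtain ⟨i, hi, -⟩ := knot_of hr h' t a b
      exact ⟨i, Finset.mem_univ _, by omega⟩
    · rintro ⟨i, -, hi⟩
      have := h2 i
      refine ⟨by omega, ?_⟩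
      have h5 := (h3 (j i) this.1 this.2).2 ⟨i, rfl⟩
      rw [DD_succ r hr, ← hi]
      intro he
      apply h5
      rw [show j i - 2 + 1 = j i - 1 by omega] at he
      linarith
  rw [this, Finset.card_image_of_injective, Finset.card_univ, Fintype.card_fin]
  intro a b hab
  apply h1.injective
  have ha := h2 a
  have hb := h2 b
  simp only at hab
  omega

lemma change_exists (f : ℕ → ℝ) (a b : ℕ) (hab : a ≤ b) (hne : f a ≠ f b) :
    ∃ p, a ≤ p ∧ p < b ∧ f p ≠ f (p + 1) := by
  by_contra hcon
  push Not at hcon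
  apply hne
  induction b, hab using Nat.le_induction with
  | base => rfl
  | succ m hm ih =>
    have h1 : f a = f m := by
      by_contra h
      exact h (ih h (fun p h1 h2 => hcon p h1 (by omega)))
    rw [h1]
    exact hcon m hm (by omega)

lemma knot_geo {r n : ℕ} (hr : 1 ≤ r) (hn : 2 * r ≤ n) {θ : Fin n → ℝ} {k : ℕ} {j : Fin k → ℕ}
    {sg : Fin k → ℝ} (h : IsKnotSeq r n θ k j sg) {c : ℝ} (hm : MinLen n r k j sg c) :
    (∀ x ∈ knotX r θ, r ≤ x ∧ x < n ∧ c * n / (k + 1) ≤ x ∧ c * n / (k + 1) + x ≤ n ∧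
      (sgn r θ x = 1 ∨ sgn r θ x = -1)) ∧
    (∀ x ∈ knotX r θ, ∀ y ∈ knotX r θ, x < y → sgn r θ x ≠ sgn r θ y →
      c * n / (k + 1) + x ≤ y) := by
  have h' := h
  obtain ⟨h1, h2, h3, h4⟩ := h
  have hsg : ∀ i, sg i ≠ 0 := by
    intro i; rw [h4 i]; split_ifs <;> norm_num
  have mem : ∀ x ∈ knotX r θ, ∃ i, j i + r = x + 2 ∧ sg i = sgn r θ x := by
    intro x hx
    unfold knotX at hx
    obtain ⟨t, ht, rfl⟩ := Finset.mem_image.1 hx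
    rw [Finset.mem_filter, Finset.mem_range] at ht
    obtain ⟨i, hi, hs⟩ := knot_of hr h' t ht.1 ht.2
    exact ⟨i, by omega, hs⟩
  have jx : ∀ p (hp : p < k), jext n r k j (p + 1) = j ⟨p, hp⟩ := by
    intro p hp
    simp only [jext, Nat.add_sub_cancel]
    rw [if_neg (by omega), dif_pos hp]
  have sx : ∀ p (hp : p < k), sgext k sg (p + 1) = sg ⟨p, hp⟩ := by
    intro p hp
    simp only [sgext, Nat.add_sub_cancel]
    rw [dif_pos ⟨by omega, hp⟩]
  constructor
  · intro x hx
    obtain ⟨i, hi, -⟩ := mem x hx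
    have hji := h2 i
    have hk : 0 < k := i.pos
    have e1 := hm 0 (by omega) (by
      rw [sx 0 hk]
      simp only [sgext, lt_irrefl, false_and, dif_neg, not_false_eq_true]
      exact (hsg _).symm)
    have e2 := hm k le_rfl (by
      obtain ⟨l, rfl⟩ : ∃ l, k = l + 1 := ⟨k - 1, by omega⟩
      rw [sx l (by omega)]
      have : sgext (l + 1) sg (l + 1 + 1) = 0 := by
        simp only [sgext]
        rw [dif_neg (by omega)]
      rw [this]; exact hsg _)
    have m1 : j ⟨0, hk⟩ ≤ j i := h1.monotone (Fin.mk_le_of_le_val (by omega))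
    have m2 : j i ≤ j ⟨k - 1, by omega⟩ := h1.monotone (Fin.le_def.2 (by simp; omega))
    have b0 := h2 ⟨0, hk⟩
    have b1 := h2 ⟨k - 1, by omega⟩
    have n0 : nlen n r k j 0 = j ⟨0, hk⟩ + r - 2 := by
      simp only [nlen, if_true]
      rw [jx 0 hk]
    have n1 : nlen n r k j k = n - r + 2 - j ⟨k - 1, by omega⟩ := by
      simp only [nlen]
      rw [if_neg (by omega)]
      have := jx (k - 1) (by omega)
      rw [Nat.sub_add_cancel hk] at this
      rw [this]
      simp only [jext, Nat.add_sub_cancel]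
      rw [if_neg (by omega), dif_neg (by omega)]
    have n0' : nlen n r k j 0 ≤ x := by rw [n0]; omega
    have n1' : nlen n r k j k + x ≤ n := by rw [n1]; omega
    have n0r : (nlen n r k j 0 : ℝ) ≤ x := by exact_mod_cast n0'
    have n1r : (nlen n r k j k : ℝ) + x ≤ n := by exact_mod_cast n1'
    refine ⟨by omega, by omega, by linarith, by linarith, ?_⟩
    unfold sgn; split_ifs <;> simp
  · intro x hx y hy hxy hs
    obtain ⟨i, hi, si⟩ := mem x hx
    obtain ⟨i', hi', si'⟩ := mem y hy
    rw [← si, ← si'] at hs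
    have hlt : i < i' := h1.lt_iff_lt.1 (by omega)
    have hlt' : i.1 < i'.1 := hlt
    obtain ⟨p, p1, p2, p3⟩ := change_exists (fun p => sgext k sg (p + 1)) i.1 i'.1 hlt'.le (by
      beta_reduce
      rw [sx i.1 i.2, sx i'.1 i'.2]; exact hs)
    have hi'k := i'.2
    have e := hm (p + 1) (by omega) p3
    have n1 : nlen n r k j (p + 1) = j ⟨p + 1, by omega⟩ - j ⟨p, by omega⟩ := by
      simp only [nlen]
      rw [if_neg (by omega), jx p (by omega), jx (p + 1) (by omega)]
    have m0 : j ⟨p, by omega⟩ < j ⟨p + 1, by omega⟩ := h1 (Fin.lt_def.2 (by simp))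
    have m1 : j i ≤ j ⟨p, by omega⟩ := h1.monotone (Fin.le_def.2 p1)
    have m2 : j ⟨p + 1, by omega⟩ ≤ j i' := h1.monotone (Fin.le_def.2 p2)
    have n1' : nlen n r k j (p + 1) + x ≤ y := by rw [n1]; omega
    have n1r : (nlen n r k j (p + 1) : ℝ) + x ≤ y := by exact_mod_cast n1'
    linarith

lemma log_final (c n : ℝ) (k : ℕ) (hc0 : 0 < c) (hc1 : c ≤ 1) (hk : (k : ℝ) + 1 ≤ n) :
    n / (c * n / (k + 1)) + (k + 1) * (1 + Real.log (1 + c * n / (k + 1)))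
      ≤ (1 / c + 8) * ((k + 1) * Real.log (Real.exp 1 * n / (k + 1))) := by
  have hk0 : (0 : ℝ) < (k : ℝ) + 1 := by positivity
  have hn0 : 0 < n := by linarith
  set K : ℝ := (k : ℝ) + 1 with hK
  have hL : 1 ≤ n / K := (one_le_div hk0).2 hk
  have e1 : n / (c * n / K) = K * (1 / c) := by field_simp
  have e2 : Real.log (Real.exp 1 * n / K) = 1 + Real.log (n / K) := by
    rw [mul_div_assoc, Real.log_mul (Real.exp_ne_zero 1) (by positivity), Real.log_exp]
  have e3 : Real.log (1 + c * n / K) ≤ Real.log (Real.exp 1 * n / K) := by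
    apply Real.log_le_log (by positivity)
    have : (2 : ℝ) ≤ Real.exp 1 := by
      have := Real.add_one_le_exp (1 : ℝ); linarith
    rw [mul_div_assoc, mul_div_assoc]
    nlinarith
  have e4 : 1 ≤ Real.log (Real.exp 1 * n / K) := by
    rw [e2]; linarith [Real.log_nonneg hL]
  set ℓ := Real.log (Real.exp 1 * n / K)
  rw [e1]
  have i1 : 0 < 1 / c := by positivity
  have : 1 / c + (1 + Real.log (1 + c * n / K)) ≤ (1 / c + 8) * ℓ := by nlinarith
  calc K * (1 / c) + K * (1 + Real.log (1 + c * n / K))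
      = K * (1 / c + (1 + Real.log (1 + c * n / K))) := by ring
    _ ≤ K * ((1 / c + 8) * ℓ) := by gcongr
    _ = _ := by ring

lemma log_final0 (c n : ℝ) (hc0 : 0 < c) (hn : 1 ≤ n) :
    n / (n / 4) + (1 + 1) * (1 + Real.log (1 + n / 4))
      ≤ (1 / c + 8) * Real.log (Real.exp 1 * n) := by
  have e1 : n / (n / 4) = 4 := by field_simp
  have e2 : Real.log (Real.exp 1 * n) = 1 + Real.log n := by
    rw [Real.log_mul (Real.exp_ne_zero 1) (by positivity), Real.log_exp]
  have e3 : Real.log (1 + n / 4) ≤ Real.log (Real.exp 1 * n) := by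
    apply Real.log_le_log (by positivity)
    have : (2 : ℝ) ≤ Real.exp 1 := by
      have := Real.add_one_le_exp (1 : ℝ); linarith
    nlinarith
  have e4 : 1 ≤ Real.log (Real.exp 1 * n) := by
    rw [e2]; linarith [Real.log_nonneg hn]
  rw [e1]
  have i1 : 0 < 1 / c := by positivity
  nlinarith

lemma zpow_r (r n : ℕ) (hr : 1 ≤ r) : (n : ℝ) ^ ((r : ℤ) - 1) = (n : ℝ) ^ (r - 1) := by
  rw [← zpow_natCast]; congr 1; omega

/-- Corollary: risk of the constrained estimator under the minimum length
condition. -/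
theorem stmt2 (r : ℕ) (hr : 1 ≤ r) (c : ℝ) (hc0 : 0 < c) (hc1 : c ≤ 1) :
    ∃ C : ℝ, 0 < C ∧
      ∀ (n : ℕ), 2 * r ≤ n → ∀ σ : ℝ, 0 < σ → ∀ V : ℝ, 0 ≤ V → ∀ θstar : Fin n → ℝ,
        ∀ (k : ℕ) (j : Fin k → ℕ) (sg : Fin k → ℝ),
          IsKnotSeq r n θstar k j sg → MinLen n r k j sg c →
          ∀ est : (Fin n → ℝ) → Fin n → ℝ, IsProjOn est (Kset r n V) →
            risk σ est θstar ≤ (V - Vr r θstar) ^ 2 +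
              C * (σ ^ 2 * ((Dl0 r θstar : ℝ) + 1) / (n : ℝ)) *
                Real.log (Real.exp 1 * (n : ℝ) / ((Dl0 r θstar : ℝ) + 1)) := by
  obtain ⟨C, hC, hmain⟩ := main_risk r hr
  refine ⟨C * (1 / c + 8), by positivity, ?_⟩
  intro n hn σ hσ V hV θs k j sg hks hml est hest
  have hn1 : 0 < n := by omega
  have hn0 : (0 : ℝ) < n := by exact_mod_cast hn1
  have hk : Dl0 r θs = k := knot_count hr hks
  have hkn : k ≤ n - r := by
    rw [← hk]; unfold Dl0
    refine (Finset.card_filter_le _ _).trans ?_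
    rw [Finset.card_range]
  have hzz : (n : ℝ) ^ (r - 1) * (n : ℝ) ^ (1 - (r : ℤ)) = 1 := by
    rw [← zpow_r r n hr, ← zpow_add₀ hn0.ne']
    rw [show (r : ℤ) - 1 + (1 - r) = 0 by ring, zpow_zero]
  have hp : 0 < (n : ℝ) ^ (r - 1) := by positivity
  have hVr : Vr r θs = (n : ℝ) ^ (r - 1) * Dl1 r θs := by unfold Vr; rw [zpow_r r n hr]
  rw [hk]
  rcases Nat.eq_zero_or_pos k with hk0 | hkpos
  · -- no knots
    subst hk0
    have hD : ∀ t < n - r, DD r θs t = 0 := by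
      intro t ht
      by_contra hne
      obtain ⟨i, -⟩ := knot_of hr hks t ht hne
      exact i.elim0
    have hD1 : Dl1 r θs = 0 := by
      unfold Dl1
      apply Finset.sum_eq_zero
      intro t ht
      rw [hD t (Finset.mem_range.1 ht), abs_zero]
    rw [hVr, hD1, mul_zero, sub_zero]
    set t0 := (n - r) / 2 with ht0
    have ht0' : t0 < n - r := by omega
    set v : ℝ := V * (n : ℝ) ^ (1 - (r : ℤ)) with hv
    have hv0 : 0 ≤ v := by positivity
    obtain ⟨θ0, d1, d2⟩ := comparator r n hr (by omega) θs (fun t => if t = t0 then v else 0)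
      (by intro t ht; rw [if_neg (by omega)])
    have hsum : ∑ t ∈ Finset.range (n - r), |if t = t0 then v else 0| = v := by
      rw [Finset.sum_eq_single t0]
      · rw [if_pos rfl, abs_of_nonneg hv0]
      · intro b _ hb; rw [if_neg hb, abs_zero]
      · intro h; exact absurd (Finset.mem_range.2 ht0') h
    have hDD : ∀ t < n - r, DD r θ0 t = if t = t0 then v else 0 := by
      intro t ht; rw [d1 t ht, hD t ht, zero_add]
    have hDl : Dl1 r θ0 = v := by
      unfold Dl1
      rw [← hsum]
      apply Finset.sum_congr rfl
      intro t ht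
      rw [hDD t (Finset.mem_range.1 ht)]
    rw [hsum, hv, mul_left_comm, hzz, mul_one] at d2
    have b1 : 2 * (t0 + r) ≥ n := by omega
    have b2 : 4 * (t0 + r) ≤ 3 * n := by omega
    have b1' : (2 : ℝ) * ((t0 + r : ℕ) : ℝ) ≥ n := by exact_mod_cast b1
    have b2' : (4 : ℝ) * ((t0 + r : ℕ) : ℝ) ≤ 3 * n := by exact_mod_cast b2
    have fin := hmain n hn1 σ hσ (n / 4) (by positivity) {t0 + r} (fun _ => 1)
      (by
        intro x hx
        rw [Finset.mem_singleton] at hx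
        subst hx
        refine ⟨by omega, by omega, by linarith, by linarith, Or.inl rfl⟩)
      (by intro x _ y _ _ h; exact absurd rfl h)
      V V est hest θ0 θs hDl d2
      (by
        intro t ht hne
        rw [hDD t ht] at hne ⊢
        have : t = t0 := by
          by_contra h; rw [if_neg h] at hne; exact hne rfl
        rw [if_pos this, abs_of_nonneg hv0, one_mul, this]
        exact ⟨Finset.mem_singleton_self _, rfl⟩)
    refine fin.trans ?_
    have lf := log_final0 c n hc0 (by exact_mod_cast hn1)
    rw [Finset.card_singleton]
    simp only [Nat.cast_one, Nat.cast_zero, zero_add, div_one, mul_one]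
    have : σ ^ 2 / n * (C * (n / (n / 4) + (1 + 1) * (1 + Real.log (1 + (n : ℝ) / 4))))
        ≤ σ ^ 2 / n * (C * ((1 / c + 8) * Real.log (Real.exp 1 * n))) := by gcongr
    have e : C * (1 / c + 8) * (σ ^ 2 / n) * Real.log (Real.exp 1 * n)
      = σ ^ 2 / n * (C * ((1 / c + 8) * Real.log (Real.exp 1 * n))) := by ring
    rw [e]; linarith
  · -- at least one knot
    have hDl1pos : 0 < Dl1 r θs := by
      unfold Dl0 at hk
      obtain ⟨t, ht⟩ := Finset.card_pos.1 (hk ▸ hkpos)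
      rw [Finset.mem_filter] at ht
      unfold Dl1
      exact Finset.sum_pos' (fun _ _ => abs_nonneg _) ⟨t, ht.1, abs_pos.2 ht.2⟩
    set W := Vr r θs with hW
    have hWpos : 0 < W := by rw [hVr]; positivity
    obtain ⟨θ0, d1, d2⟩ := comparator r n hr (by omega) θs
      (fun t => if t < n - r then (V / W - 1) * DD r θs t else 0)
      (by intro t ht; rw [if_neg (by omega)])
    have hDD : ∀ t < n - r, DD r θ0 t = V / W * DD r θs t := by
      intro t ht; rw [d1 t ht, if_pos ht]; ring
    have hVW : 0 ≤ V / W := by positivity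
    have hsum : ∑ t ∈ Finset.range (n - r), |if t < n - r then (V / W - 1) * DD r θs t else 0|
        = |V / W - 1| * Dl1 r θs := by
      unfold Dl1
      rw [Finset.mul_sum]
      apply Finset.sum_congr rfl
      intro t ht
      rw [if_pos (Finset.mem_range.1 ht), abs_mul]
    have hDl : Dl1 r θ0 = V * (n : ℝ) ^ (1 - (r : ℤ)) := by
      have : Dl1 r θ0 = V / W * Dl1 r θs := by
        unfold Dl1
        rw [Finset.mul_sum]
        apply Finset.sum_congr rfl
        intro t ht
        rw [hDD t (Finset.mem_range.1 ht), abs_mul, abs_of_nonneg hVW]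
      have h2 : Dl1 r θs = W * (n : ℝ) ^ (1 - (r : ℤ)) := by
        rw [hVr, mul_right_comm, hzz, one_mul]
      rw [this, h2]
      field_simp
    have d3 : sqnorm (θ0 - θs) ≤ n * (V - W) ^ 2 := by
      refine d2.trans (le_of_eq ?_)
      rw [hsum, mul_left_comm, ← hVr, mul_pow, sq_abs]
      field_simp
    obtain ⟨g1, g2⟩ := knot_geo hr hn hks hml
    have fin := hmain n hn1 σ hσ (c * n / (k + 1)) (by positivity) (knotX r θs) (sgn r θs) g1 g2
      V (V - W) est hest θ0 θs hDl d3
      (by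
        intro t ht hne
        rw [hDD t ht] at hne ⊢
        have hne' : DD r θs t ≠ 0 := right_ne_zero_of_mul hne
        refine ⟨Finset.mem_image.2 ⟨t, Finset.mem_filter.2 ⟨Finset.mem_range.2 ht, hne'⟩, rfl⟩, ?_⟩
        unfold sgn
        rw [Nat.add_sub_cancel, abs_mul, abs_of_nonneg hVW]
        split_ifs with h
        · rw [abs_of_pos h, one_mul]
        · rw [abs_of_nonpos (not_lt.1 h)]; ring)
    refine fin.trans ?_
    rw [knotX_card, hk]
    have hkn' : (k : ℝ) + 1 ≤ n := by
      have : k + 1 ≤ n := by omega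
      exact_mod_cast this
    have lf := log_final c n k hc0 hc1 hkn'
    have : σ ^ 2 / n * (C * (n / (c * n / (k + 1)) + (k + 1) * (1 + Real.log (1 + c * n / (k + 1)))))
        ≤ σ ^ 2 / n * (C * ((1 / c + 8) * ((k + 1) * Real.log (Real.exp 1 * n / (k + 1))))) := by
      gcongr
    have e : C * (1 / c + 8) * (σ ^ 2 * (k + 1) / n) * Real.log (Real.exp 1 * n / (k + 1))
      = σ ^ 2 / n * (C * ((1 / c + 8) * ((k + 1) * Real.log (Real.exp 1 * n / (k + 1))))) := by ring
    rw [e]; linarith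
end
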